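/- arXiv:2105.14563 — 2 statements merged into one kernel-verified Lean document; each statement's English description precedes it below -/
import Mathlib

section
/- For every p ∈ [2,∞) there is a constant C = C(p) such that for all n, R ∈ ℕ and all functions F_1,…,F_n : {-1,1}^n → ℝ^R, one has E_ε |Σ_{i=1}^n Δ^{-1/2} D_i F_i(ε)|_{ℓ²}^p ≤ C · E_{δ,ε} |Σ_{i=1}^n δ_i D_i F_i(ε)|_{ℓ²}^p, where Δ^{-1/2} and D_i act coordinatewise on ℝ^R-valued functions and |·|_{ℓ²} is the Euclidean norm on ℝ^R. -/
open scoped BigOperators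
open Finset

noncomputable section

/-- The ±1 value of a Boolean coordinate. -/
def rad (b : Bool) : ℝ := if b then 1 else -1

/-- Expectation over the uniform measure on the discrete cube `{-1,1}^n`
(points encoded as `Fin n → Bool`). -/
def cubeAvg {n : ℕ} {X : Type*} [AddCommGroup X] [Module ℝ X]
    (f : (Fin n → Bool) → X) : X :=
  ((2 ^ n : ℝ)⁻¹) • ∑ ε : Fin n → Bool, f ε

/-- Walsh character `w_A(ε) = ∏_{i ∈ A} ε_i`. -/
def walshChar {n : ℕ} (A : Finset (Fin n)) (ε : Fin n → Bool) : ℝ :=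
  ∏ i ∈ A, rad (ε i)

/-- Walsh coefficient `f̂(A) = E_ε [f(ε) w_A(ε)]`. -/
def wcoef {n : ℕ} {X : Type*} [AddCommGroup X] [Module ℝ X]
    (f : (Fin n → Bool) → X) (A : Finset (Fin n)) : X :=
  cubeAvg (fun ε => walshChar A ε • f ε)

/-- Flip the `j`-th coordinate. -/
def flipCoord {n : ℕ} (j : Fin n) (ε : Fin n → Bool) : Fin n → Bool :=
  Function.update ε j (!(ε j))

/-- Discrete derivative `D_j f(ε) = (f(ε) - f(σ_j ε))/2`. -/
def Dop {n : ℕ} {X : Type*} [AddCommGroup X] [Module ℝ X]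
    (j : Fin n) (f : (Fin n → Bool) → X) : (Fin n → Bool) → X :=
  fun ε => (2 : ℝ)⁻¹ • (f ε - f (flipCoord j ε))

/-- Heat semigroup `P_t f = Σ_A e^{-t|A|} f̂(A) w_A`. -/
def heatOp {n : ℕ} {X : Type*} [AddCommGroup X] [Module ℝ X]
    (t : ℝ) (f : (Fin n → Bool) → X) : (Fin n → Bool) → X :=
  fun ε => ∑ A : Finset (Fin n), (Real.exp (-t * A.card) * walshChar A ε) • wcoef f A

/-- Fractional power of the Laplacian on mean-zero parts:
`Δ^a f = Σ_{A ≠ ∅} |A|^a f̂(A) w_A`. -/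
def lapPow {n : ℕ} {X : Type*} [AddCommGroup X] [Module ℝ X]
    (a : ℝ) (f : (Fin n → Bool) → X) : (Fin n → Bool) → X :=
  fun ε => ∑ A ∈ Finset.univ.filter (fun A : Finset (Fin n) => A ≠ ∅),
    (((A.card : ℝ)) ^ a * walshChar A ε) • wcoef f A

/-- `X` has cotype `q` with constant `K`. -/
def HasCotypeConst (X : Type*) [NormedAddCommGroup X] [NormedSpace ℝ X] (q K : ℝ) : Prop :=
  ∀ m : ℕ, ∀ x : Fin m → X,
    (∑ j, ‖x j‖ ^ q) ^ (1 / q) ≤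
      K * (cubeAvg (fun δ : Fin m → Bool => ‖∑ j, rad (δ j) • x j‖ ^ (2 : ℝ))) ^ (1 / 2 : ℝ)

/-- `X` has type `s` with constant `T`. -/
def HasTypeConst (X : Type*) [NormedAddCommGroup X] [NormedSpace ℝ X] (s T : ℝ) : Prop :=
  ∀ m : ℕ, ∀ x : Fin m → X,
    (cubeAvg (fun δ : Fin m → Bool => ‖∑ j, rad (δ j) • x j‖ ^ (2 : ℝ))) ^ (1 / 2 : ℝ) ≤
      T * (∑ j, ‖x j‖ ^ s) ^ (1 / s)

/-- The Bellman function in terms of `X = |u|^2+1`, `Y = |v|^2+1`. -/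
def rbPhi (A K p a X Y : ℝ) : ℝ :=
  A * X ^ (p / 2) + K * Y ^ ((1 + a) / 2) - Y ^ ((1 + 3 * a) / 2) / (X + Y ^ a)

def rbPhiX (A p a X Y : ℝ) : ℝ :=
  A * (p / 2) * X ^ (p / 2 - 1) + Y ^ ((1 + 3 * a) / 2) / (X + Y ^ a) ^ 2

def rbPhiY (K a X Y : ℝ) : ℝ :=
  K * ((1 + a) / 2) * Y ^ ((1 + a) / 2 - 1)
    - ((1 + 3 * a) / 2) * Y ^ ((1 + 3 * a) / 2 - 1) / (X + Y ^ a)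
    + Y ^ ((1 + 3 * a) / 2) * (a * Y ^ (a - 1)) / (X + Y ^ a) ^ 2

def rbHess (A K p a X Y X1 Y1 : ℝ) : ℝ :=
  (A * (p / 2) * (p / 2 - 1) * X ^ (p / 2 - 1 - 1)
    - 2 * Y ^ ((1 + 3 * a) / 2) / (X + Y ^ a) ^ 3) * X1 ^ 2
  + 2 * (((1 + 3 * a) / 2) * Y ^ ((1 + 3 * a) / 2 - 1) / (X + Y ^ a) ^ 2
    - 2 * Y ^ ((1 + 3 * a) / 2) * (a * Y ^ (a - 1)) / (X + Y ^ a) ^ 3) * X1 * Y1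
  + (K * ((1 + a) / 2) * ((1 + a) / 2 - 1) * Y ^ ((1 + a) / 2 - 1 - 1)
    - ((1 + 3 * a) / 2) * ((1 + 3 * a) / 2 - 1) * Y ^ ((1 + 3 * a) / 2 - 1 - 1) / (X + Y ^ a)
    + 2 * ((1 + 3 * a) / 2) * Y ^ ((1 + 3 * a) / 2 - 1) * (a * Y ^ (a - 1)) / (X + Y ^ a) ^ 2
    + Y ^ ((1 + 3 * a) / 2) * (a * (a - 1) * Y ^ (a - 1 - 1)) / (X + Y ^ a) ^ 2
    - 2 * Y ^ ((1 + 3 * a) / 2) * (a * Y ^ (a - 1)) ^ 2 / (X + Y ^ a) ^ 3) * Y1 ^ 2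

lemma rb_deriv1 (A K p a : ℝ) {X Y : ℝ → ℝ} {X1 Y1 t : ℝ} (hX : HasDerivAt X X1 t)
    (hY : HasDerivAt Y Y1 t) (hX0 : 0 < X t) (hY0 : 0 < Y t) :
    HasDerivAt (fun s => rbPhi A K p a (X s) (Y s))
      (rbPhiX A p a (X t) (Y t) * X1 + rbPhiY K a (X t) (Y t) * Y1) t := by
  have hD : X t + Y t ^ a ≠ 0 := by positivity
  have h1 := (hX.rpow_const (p := p / 2) (Or.inl hX0.ne')).const_mul A
  have h2 := (hY.rpow_const (p := (1 + a) / 2) (Or.inl hY0.ne')).const_mul K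
  have h3 := (hY.rpow_const (p := (1 + 3 * a) / 2) (Or.inl hY0.ne'))
  have h4 := hX.add (hY.rpow_const (p := a) (Or.inl hY0.ne'))
  have h5 := (h1.add h2).sub (h3.div h4 hD)
  refine h5.congr_deriv ?_
  simp only [rbPhiX, rbPhiY, Pi.add_apply]
  field_simp
  ring

lemma rb_deriv2 (A K p a : ℝ) {X Y X1 Y1 : ℝ → ℝ} {X2 Y2 t : ℝ} (hX : HasDerivAt X (X1 t) t)
    (hY : HasDerivAt Y (Y1 t) t) (hX1 : HasDerivAt X1 X2 t) (hY1 : HasDerivAt Y1 Y2 t)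
    (hX0 : 0 < X t) (hY0 : 0 < Y t) :
    HasDerivAt (fun s => rbPhiX A p a (X s) (Y s) * X1 s + rbPhiY K a (X s) (Y s) * Y1 s)
      (rbHess A K p a (X t) (Y t) (X1 t) (Y1 t)
        + rbPhiX A p a (X t) (Y t) * X2 + rbPhiY K a (X t) (Y t) * Y2) t := by
  have hD : X t + Y t ^ a ≠ 0 := by positivity
  have hD2 : (X t + Y t ^ a) ^ 2 ≠ 0 := by positivity
  have h1 := (hX.rpow_const (p := p / 2 - 1) (Or.inl hX0.ne')).const_mul (A * (p / 2))
  have h2 := (hY.rpow_const (p := (1 + a) / 2 - 1) (Or.inl hY0.ne')).const_mul (K * ((1 + a) / 2))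
  have h3 := (hY.rpow_const (p := (1 + 3 * a) / 2) (Or.inl hY0.ne'))
  have h3' := (hY.rpow_const (p := (1 + 3 * a) / 2 - 1) (Or.inl hY0.ne')).const_mul
    ((1 + 3 * a) / 2)
  have h4 := hX.add (hY.rpow_const (p := a) (Or.inl hY0.ne'))
  have h4' := (hY.rpow_const (p := a - 1) (Or.inl hY0.ne')).const_mul a
  have h42 := h4.pow 2
  have e1 := (h1.add (h3.div h42 hD2)).mul hX1
  have e2 := ((h2.sub (h3'.div h4 hD)).add ((h3.mul h4').div h42 hD2)).mul hY1
  refine (e1.add e2).congr_deriv ?_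
  simp only [rbPhiX, rbPhiY, rbHess, Pi.add_apply, Pi.sub_apply, Pi.div_apply, Pi.mul_apply,
    Pi.pow_apply]
  generalize Y t ^ ((1 + 3 * a) / 2 - 1 - 1) = y1
  generalize Y t ^ ((1 + 3 * a) / 2 - 1) = y2
  generalize Y t ^ ((1 + 3 * a) / 2) = y3
  generalize Y t ^ ((1 + a) / 2 - 1 - 1) = y4
  generalize Y t ^ ((1 + a) / 2 - 1) = y5
  generalize Y t ^ (a - 1 - 1) = y6
  generalize Y t ^ (a - 1) = y7
  generalize Y t ^ a = y8 at *
  generalize X t ^ (p / 2 - 1 - 1) = x1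
  generalize X t ^ (p / 2 - 1) = x2
  have : X t = (X t + y8) - y8 := by ring
  generalize X t + y8 = D at *
  field_simp
  ring

/-- algebraic core -/
lemma rb_core (a r x2 m l E : ℝ) (ha0 : 0 < a) (ha1 : a ≤ 1) (hr0 : 0 ≤ r) (hr1 : r ≤ 1)
    (hm : m ^ 2 ≤ 2 * (1 - r) * x2) (hl : l ^ 2 ≤ 4 * E) :
    x2 * (1 - 6 * (1 - r)) - 40 * E ≤
      x2 + (-((1 + 3 * a) / 2) + a * r) * (2 * E) - 2 * m ^ 2
      + 2 * ((1 + 3 * a) / 2 - 2 * a * r) * m * l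
      + l ^ 2 * (-((1 + 3 * a) / 2) * ((1 + 3 * a) / 2 - 1) + 2 * a * ((1 + 3 * a) / 2) * r
        + a * (a - 1) * r - 2 * a ^ 2 * r ^ 2) := by
  have hE : 0 ≤ E := by nlinarith [sq_nonneg l]
  have har0 : 0 ≤ a * r := by positivity
  have har1 : a * r ≤ 1 := by nlinarith
  have h1 : -(m ^ 2) - 4 * l ^ 2 ≤ 2 * ((1 + 3 * a) / 2 - 2 * a * r) * m * l := by
    have hc : |(1 + 3 * a) / 2 - 2 * a * r| ≤ 2 := by
      rw [abs_le]; constructor <;> nlinarith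
    have : ((1 + 3 * a) / 2 - 2 * a * r) ^ 2 ≤ 4 := by
      rw [← sq_abs]; nlinarith [abs_nonneg ((1 + 3 * a) / 2 - 2 * a * r)]
    nlinarith [sq_nonneg (m + ((1 + 3 * a) / 2 - 2 * a * r) * l), sq_nonneg l]
  have h2 : -5 ≤ (-((1 + 3 * a) / 2) * ((1 + 3 * a) / 2 - 1) + 2 * a * ((1 + 3 * a) / 2) * r
        + a * (a - 1) * r - 2 * a ^ 2 * r ^ 2) := by
    have e1 : ((1 + 3 * a) / 2) * ((1 + 3 * a) / 2 - 1) ≤ 2 := by nlinarith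
    have e2 : 0 ≤ 2 * a * ((1 + 3 * a) / 2) * r := by positivity
    have e3 : (a * r) * (1 - a) ≤ 1 := by nlinarith
    have e4 : (a * r) ^ 2 ≤ 1 := by nlinarith
    nlinarith
  have h3 : -5 * l ^ 2 ≤ l ^ 2 * (-((1 + 3 * a) / 2) * ((1 + 3 * a) / 2 - 1)
        + 2 * a * ((1 + 3 * a) / 2) * r
        + a * (a - 1) * r - 2 * a ^ 2 * r ^ 2) := by nlinarith [sq_nonneg l]
  have h4 : -(4 * E) ≤ (-((1 + 3 * a) / 2) + a * r) * (2 * E) := by nlinarith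
  nlinarith

lemma rb_r1 (r : ℝ) (h0 : 0 ≤ r) (h1 : r ≤ 1) : -10 ≤ 2 * r ^ 2 * (1 - 6 * (1 - r)) := by
  have e1 : r ^ 2 ≤ 1 := by nlinarith
  have e2 : 0 ≤ r ^ 2 * r := by positivity
  nlinarith

lemma rb_r2 (r : ℝ) (h0 : 16 / 17 ≤ r) : 1 / 2 ≤ 2 * r ^ 2 * (1 - 6 * (1 - r)) := by
  have e1 : (1:ℝ)/2 ≤ 1 - 6 * (1 - r) := by linarith
  have e2 : (1:ℝ)/2 ≤ r ^ 2 := by nlinarith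
  nlinarith

set_option maxHeartbeats 1000000 in
lemma rb_hess_lower (A K p a X Y X1 Y1 z2 e2 : ℝ) (hp : 2 ≤ p) (ha0 : 0 < a) (ha1 : a ≤ 1)
    (hpa : a * p = 1 + a) (hA : 11 * 16 ^ (p / 2 - 1) ≤ A) (hK : 41 ≤ K * a)
    (hX : 0 < X) (hY : 0 < Y) (hX1 : X1 ^ 2 ≤ 4 * X * z2) (hY1 : Y1 ^ 2 ≤ 4 * Y * e2) 
    (hz2 : 0 ≤ z2) (he2 : 0 ≤ e2) :
    1 / 2 * Y ^ ((1 - a) / 2) * z2 + Y ^ (-((1 - a) / 2)) * e2 ≤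
      rbHess A K p a X Y X1 Y1 + rbPhiX A p a X Y * (2 * z2) + rbPhiY K a X Y * (2 * e2) := by
  have hA0 : 0 < A := lt_of_lt_of_le (by positivity) hA
  have hK0 : 0 < K := by
    by_contra h
    nlinarith
  obtain ⟨S, hS⟩ : ∃ S, S = Y ^ a := ⟨_, rfl⟩
  obtain ⟨Q, hQ⟩ : ∃ Q, Q = Y ^ ((1 + a) / 2) := ⟨_, rfl⟩
  obtain ⟨W, hW⟩ : ∃ W, W = X ^ (p / 2) := ⟨_, rfl⟩
  have hS0 : 0 < S := by rw [hS]; positivity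
  have hQ0 : 0 < Q := by rw [hQ]; positivity
  have hW0 : 0 < W := by rw [hW]; positivity
  have e1 : Y ^ ((1 + 3 * a) / 2) = Q * S := by
    rw [hQ, hS, ← Real.rpow_add hY]; congr 1; ring
  have e2' : Y ^ ((1 - a) / 2) = Q / S := by
    rw [hQ, hS, ← Real.rpow_sub hY]; congr 1; ring
  have e3 : Y ^ (-((1 - a) / 2)) = Q / Y := by
    rw [hQ, ← Real.rpow_sub_one hY.ne']; congr 1; ring
  have hQS : Q / S = S ^ (p / 2 - 1) := by
    rw [← e2', hS, ← Real.rpow_mul hY.le]; congr 1; linarith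
  have hWX : W / X = X ^ (p / 2 - 1) := by
    rw [hW, ← Real.rpow_sub_one hX.ne']
  have hcase : S ≤ 16 * X → 11 * (Q / S) ≤ A * (W / X) := by
    intro h
    rw [hQS, hWX]
    calc 11 * S ^ (p / 2 - 1) ≤ 11 * (16 * X) ^ (p / 2 - 1) := by
          gcongr; linarith
      _ = 11 * 16 ^ (p / 2 - 1) * X ^ (p / 2 - 1) := by
          rw [Real.mul_rpow (by norm_num) hX.le]; ring
      _ ≤ _ := by gcongr
  simp only [rbHess, rbPhiX, rbPhiY, Real.rpow_sub_one hX.ne', Real.rpow_sub_one hY.ne', e1, e2', e3]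
  rw [← hS, ← hQ, ← hW]
  obtain ⟨D, hD⟩ : ∃ D, D = X + S := ⟨_, rfl⟩
  rw [← hD]
  have hD0 : 0 < D := by rw [hD]; positivity
  have hr1 : S / D ≤ 1 := by rw [div_le_one hD0]; linarith
  have hXD : 1 - S / D = X / D := by field_simp; linarith
  have core := rb_core a (S / D) (2 * z2 / D) (X1 / D) (Y1 / Y) (e2 / Y) ha0 ha1 (by positivity) hr1
    (by
      rw [hXD, div_pow, div_le_iff₀ (by positivity)]
      calc X1 ^ 2 ≤ _ := hX1
        _ = _ := by field_simp; ring)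
    (by
      rw [div_pow, div_le_iff₀ (by positivity)]
      calc Y1 ^ 2 ≤ _ := hY1
        _ = _ := by field_simp)
  have core2 := mul_le_mul_of_nonneg_left core (show 0 ≤ Q * (S / D) by positivity)
  have hApart : A * p * (W / X) * z2 ≤ A * (p / 2) * (p / 2 - 1) * (W / X / X) * X1 ^ 2
      + A * (p / 2) * (W / X) * (2 * z2) := by
    have : 0 ≤ A * (p / 2) * (p / 2 - 1) * (W / X / X) * X1 ^ 2 := by
      have : 0 ≤ p / 2 - 1 := by linarith
      positivity
    linarith
  have hKpart : 41 * (Q / Y) * e2 ≤ K * ((1 + a) / 2) * ((1 + a) / 2 - 1) * (Q / Y / Y) * Y1 ^ 2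
      + K * ((1 + a) / 2) * (Q / Y) * (2 * e2) := by
    have h1 : K * ((1 + a) / 2) * (1 - (1 + a) / 2) * (Q / Y / Y) * Y1 ^ 2 ≤
        K * ((1 + a) / 2) * (1 - (1 + a) / 2) * (Q / Y / Y) * (4 * Y * e2) := by
      have : 0 ≤ 1 - (1 + a) / 2 := by linarith
      gcongr
    have h2 : K * ((1 + a) / 2) * (1 - (1 + a) / 2) * (Q / Y / Y) * (4 * Y * e2) =
       K * (1 + a) * (1 - a) * ((Q / Y) * e2) := by field_simp; ring
    have h3 : 41 * ((Q / Y) * e2) ≤ K * a * (1 + a) * ((Q / Y) * e2) := by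
      have : 41 ≤ K * a * (1 + a) := by nlinarith
      gcongr
    have h4 : K * (1 + a) * (1 - a) * ((Q / Y) * e2) + K * a * (1 + a) * ((Q / Y) * e2)
       = K * ((1 + a) / 2) * (Q / Y) * (2 * e2) := by ring
    have h5 : K * ((1 + a) / 2) * ((1 + a) / 2 - 1) * (Q / Y / Y) * Y1 ^ 2 =
      -(K * ((1 + a) / 2) * (1 - (1 + a) / 2) * (Q / Y / Y) * Y1 ^ 2) := by ring
    have h6 : 41 * (Q / Y) * e2 = 41 * ((Q / Y) * e2) := by ring
    linarith
  have hz : 1 / 2 * (Q / S) * z2 ≤ A * p * (W / X) * z2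
      + Q * (S / D) * ((2 * z2 / D) * (1 - 6 * (1 - S / D))) := by
    have hid : Q * (S / D) * ((2 * z2 / D) * (1 - 6 * (1 - S / D))) =
        (Q / S) * z2 * (2 * (S / D) ^ 2 * (1 - 6 * (1 - S / D))) := by field_simp
    rw [hid]
    have hqz : 0 ≤ (Q / S) * z2 := by positivity
    rcases le_total S (16 * X) with h | h
    · have h1 : 11 * (Q / S) * z2 ≤ A * p * (W / X) * z2 := by
        have := hcase h
        have h' : A * (W / X) ≤ A * p * (W / X) := by
          have : 0 ≤ A * (W / X) := by positivity
          nlinarith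
        exact mul_le_mul_of_nonneg_right (this.trans h') hz2
      have h2 := mul_le_mul_of_nonneg_left (rb_r1 (S / D) (by positivity) hr1) hqz
      linarith
    · have h1 : 16 / 17 ≤ S / D := by
        rw [le_div_iff₀ hD0]; linarith
      have h2 := mul_le_mul_of_nonneg_left (rb_r2 (S / D) h1) hqz
      have h3 : 0 ≤ A * p * (W / X) * z2 := by positivity
      linarith
  have hE : Q * (S / D) * (40 * (e2 / Y)) ≤ 40 * (Q / Y) * e2 := by
    have : 0 ≤ 40 * (Q / Y) * e2 := by positivity
    calc Q * (S / D) * (40 * (e2 / Y)) = (S / D) * (40 * (Q / Y) * e2) := by ring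
      _ ≤ 1 * (40 * (Q / Y) * e2) := by gcongr
      _ = _ := by ring
  have key := add_le_add (add_le_add hApart hKpart) core2
  refine le_trans ?_ (key.trans (le_of_eq ?_))
  · rw [mul_sub]
    linarith
  · ring

lemma rb_taylor (f f' f'' : ℝ → ℝ) (k : ℝ) (h1 : ∀ t, HasDerivAt f (f' t) t)
    (h2 : ∀ t, HasDerivAt f' (f'' t) t) (h3 : ∀ t, 0 ≤ t → t ≤ 1 → k ≤ f'' t) :
    f 0 + f' 0 + k / 2 ≤ f 1 := by
  have m1 : MonotoneOn (fun t => f' t - k * t) (Set.Icc 0 1) := by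
    have hd : ∀ t, HasDerivAt (fun t => f' t - k * t) (f'' t - k) t := fun t => by
      exact ((h2 t).sub ((hasDerivAt_id t).const_mul k)).congr_deriv (by simp)
    refine monotoneOn_of_hasDerivWithinAt_nonneg (convex_Icc 0 1)
      (fun t _ => (hd t).continuousAt.continuousWithinAt)
      (fun t _ => (hd t).hasDerivWithinAt) (fun t ht => ?_)
    rw [interior_Icc] at ht
    linarith [h3 t ht.1.le ht.2.le]
  have m2 : MonotoneOn (fun t => f t - f' 0 * t - k / 2 * t ^ 2) (Set.Icc 0 1) := by
    have hd : ∀ t, HasDerivAt (fun t => f t - f' 0 * t - k / 2 * t ^ 2)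
        (f' t - f' 0 - k * t) t := fun t => by
      have := ((h1 t).sub ((hasDerivAt_id t).const_mul (f' 0))).sub
        (((hasDerivAt_id t).pow 2).const_mul (k / 2))
      refine this.congr_deriv ?_
      simp
      ring
    refine monotoneOn_of_hasDerivWithinAt_nonneg (convex_Icc 0 1)
      (fun t _ => (hd t).continuousAt.continuousWithinAt)
      (fun t _ => (hd t).hasDerivWithinAt) (fun t ht => ?_)
    rw [interior_Icc] at ht
    have := m1 (by simp : (0:ℝ) ∈ Set.Icc (0:ℝ) 1) ⟨ht.1.le, ht.2.le⟩ ht.1.le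
    simp only at this
    linarith
  have := m2 (by simp : (0:ℝ) ∈ Set.Icc (0:ℝ) 1) (by simp : (1:ℝ) ∈ Set.Icc (0:ℝ) 1) zero_le_one
  simp only at this
  linarith

section bell
variable {H V : Type*} [NormedAddCommGroup H] [InnerProductSpace ℝ H]
  [NormedAddCommGroup V] [InnerProductSpace ℝ V]

/-- hypotheses on the parameters -/
structure RbPar (A K p a : ℝ) : Prop where
  hp : 2 ≤ p
  ha0 : 0 < a
  ha1 : a ≤ 1
  hpa : a * p = 1 + a
  hA : 11 * 16 ^ (p / 2 - 1) ≤ A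
  hK : 41 ≤ K * a

def rbB (A K p a : ℝ) (u : H) (v : V) : ℝ := rbPhi A K p a (‖u‖ ^ 2 + 1) (‖v‖ ^ 2 + 1)

def rbGrad (A K p a : ℝ) (u : H) (v : V) (z : H) (e : V) : ℝ :=
  rbPhiX A p a (‖u‖ ^ 2 + 1) (‖v‖ ^ 2 + 1) * (2 * inner ℝ u z) +
    rbPhiY K a (‖u‖ ^ 2 + 1) (‖v‖ ^ 2 + 1) * (2 * inner ℝ v e)

def rbH2 (A K p a : ℝ) (u : H) (v : V) (z : H) (e : V) : ℝ :=
  rbHess A K p a (‖u‖ ^ 2 + 1) (‖v‖ ^ 2 + 1) (2 * inner ℝ u z) (2 * inner ℝ v e) +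
  rbPhiX A p a (‖u‖ ^ 2 + 1) (‖v‖ ^ 2 + 1) * (2 * ‖z‖ ^ 2) +
    rbPhiY K a (‖u‖ ^ 2 + 1) (‖v‖ ^ 2 + 1) * (2 * ‖e‖ ^ 2)

lemma rbB_deriv (A K p a : ℝ) {u : ℝ → H} {v : ℝ → V} {u1 : H} {v1 : V} {t : ℝ}
    (hu : HasDerivAt u u1 t) (hv : HasDerivAt v v1 t) :
    HasDerivAt (fun s => rbB A K p a (u s) (v s)) (rbGrad A K p a (u t) (v t) u1 v1) t :=
  rb_deriv1 A K p a (hu.norm_sq.add_const 1) (hv.norm_sq.add_const 1)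
    (by positivity) (by positivity)

lemma rbB_deriv2 (A K p a : ℝ) {u u1 : ℝ → H} {v v1 : ℝ → V} {u2 : H} {v2 : V} {t : ℝ}
    (hu : HasDerivAt u (u1 t) t) (hv : HasDerivAt v (v1 t) t)
    (hu1 : HasDerivAt u1 u2 t) (hv1 : HasDerivAt v1 v2 t) :
    HasDerivAt (fun s => rbGrad A K p a (u s) (v s) (u1 s) (v1 s))
      (rbH2 A K p a (u t) (v t) (u1 t) (v1 t) + rbGrad A K p a (u t) (v t) u2 v2) t := by
  have hX1 : HasDerivAt (fun s => 2 * inner ℝ (u s) (u1 s))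
      (2 * (inner ℝ (u t) u2 + inner ℝ (u1 t) (u1 t))) t := (hu.inner ℝ hu1).const_mul 2
  have hY1 : HasDerivAt (fun s => 2 * inner ℝ (v s) (v1 s))
      (2 * (inner ℝ (v t) v2 + inner ℝ (v1 t) (v1 t))) t := (hv.inner ℝ hv1).const_mul 2
  have := rb_deriv2 A K p a (hu.norm_sq.add_const 1) (hv.norm_sq.add_const 1) hX1 hY1
    (by positivity) (by positivity)
  refine this.congr_deriv ?_
  simp only [rbH2, rbGrad, real_inner_self_eq_norm_sq]
  ring

lemma rbH2_lower {A K p a : ℝ} (P : RbPar A K p a) (u : H) (v : V) (z : H) (e : V) :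
    1 / 2 * (‖v‖ ^ 2 + 1) ^ ((1 - a) / 2) * ‖z‖ ^ 2 + (‖v‖ ^ 2 + 1) ^ (-((1 - a) / 2)) * ‖e‖ ^ 2 ≤
      rbH2 A K p a u v z e := by
  have aux : ∀ {W : Type _} [NormedAddCommGroup W] [InnerProductSpace ℝ W] (x y : W),
      (2 * inner ℝ x y) ^ 2 ≤ 4 * (‖x‖ ^ 2 + 1) * ‖y‖ ^ 2 := by
    intro W _ _ x y
    have := abs_real_inner_le_norm x y
    have h2 : (inner ℝ x y) ^ 2 ≤ (‖x‖ * ‖y‖) ^ 2 := by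
      rw [← sq_abs]; gcongr
    nlinarith [sq_nonneg ‖y‖]
  have aux' : ∀ {W : Type _} [NormedAddCommGroup W] [InnerProductSpace ℝ W] (x y : W),
      (2 * inner ℝ x y) ^ 2 ≤ 4 * (‖x‖ ^ 2 + 1) * ‖y‖ ^ 2 := by
    intro W _ _ x y
    have := abs_real_inner_le_norm x y
    have h2 : (inner ℝ x y) ^ 2 ≤ (‖x‖ * ‖y‖) ^ 2 := by
      rw [← sq_abs]; gcongr
    nlinarith [sq_nonneg ‖y‖]
  exact rb_hess_lower A K p a _ _ _ _ _ _ P.hp P.ha0 P.ha1 P.hpa P.hA P.hK (by positivity)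
    (by positivity) (aux u z) (aux' v e) (by positivity) (by positivity)

lemma rbB_tangent {A K p a : ℝ} (P : RbPar A K p a) (u u' : H) (v v' : V) :
    rbB A K p a u v + rbGrad A K p a u v (u' - u) (v' - v) +
      1 / 2 * (max (‖v‖ ^ 2 + 1) (‖v'‖ ^ 2 + 1)) ^ (-((1 - a) / 2)) * ‖v' - v‖ ^ 2 ≤
    rbB A K p a u' v' := by
  have hu : ∀ t : ℝ, HasDerivAt (fun s : ℝ => u + s • (u' - u)) (u' - u) t := fun t => by
    simpa using ((hasDerivAt_id t).smul_const (u' - u)).const_add u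
  have hv : ∀ t : ℝ, HasDerivAt (fun s : ℝ => v + s • (v' - v)) (v' - v) t := fun t => by
    simpa using ((hasDerivAt_id t).smul_const (v' - v)).const_add v
  have := rb_taylor _ _ _ 
    ((max (‖v‖ ^ 2 + 1) (‖v'‖ ^ 2 + 1)) ^ (-((1 - a) / 2)) * ‖v' - v‖ ^ 2)
    (fun t => rbB_deriv A K p a (hu t) (hv t))
    (fun t => rbB_deriv2 A K p a (u1 := fun _ => u' - u) (v1 := fun _ => v' - v) (hu t) (hv t)
      (hasDerivAt_const t _) (hasDerivAt_const t _)) (by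
      intro t h0 h1
      have h2 := rbH2_lower P (u + t • (u' - u)) (v + t • (v' - v)) (u' - u) (v' - v)
      have hg : rbGrad A K p a (u + t • (u' - u)) (v + t • (v' - v)) 0 0 = 0 := by simp [rbGrad]
      rw [hg, add_zero]
      refine le_trans ?_ h2
      have hY : ‖v + t • (v' - v)‖ ^ 2 + 1 ≤ max (‖v‖ ^ 2 + 1) (‖v'‖ ^ 2 + 1) := by
        have hn : ‖v + t • (v' - v)‖ ≤ (1 - t) * ‖v‖ + t * ‖v'‖ := by
          have : v + t • (v' - v) = (1 - t) • v + t • v' := by module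
          rw [this]
          refine (norm_add_le _ _).trans ?_
          rw [norm_smul, norm_smul, Real.norm_of_nonneg h0, Real.norm_of_nonneg (by linarith)]
        rcases le_total ‖v‖ ‖v'‖ with h | h
        · refine le_max_of_le_right ?_
          have : ‖v + t • (v' - v)‖ ≤ ‖v'‖ := by nlinarith
          gcongr
        · refine le_max_of_le_left ?_
          have : ‖v + t • (v' - v)‖ ≤ ‖v‖ := by nlinarith
          gcongr
      have hR : (max (‖v‖ ^ 2 + 1) (‖v'‖ ^ 2 + 1)) ^ (-((1 - a) / 2)) ≤
          (‖v + t • (v' - v)‖ ^ 2 + 1) ^ (-((1 - a) / 2)) :=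
        Real.rpow_le_rpow_of_nonpos (by positivity) hY (by linarith [P.ha1])
      have h3 : 0 ≤ 1 / 2 * (‖v + t • (v' - v)‖ ^ 2 + 1) ^ ((1 - a) / 2) * ‖u' - u‖ ^ 2 := by
        positivity
      have h4 := mul_le_mul_of_nonneg_right hR (sq_nonneg ‖v' - v‖)
      linarith)
  simp only [zero_smul, add_zero, one_smul, add_sub_cancel] at this
  linarith

lemma rbB_nonneg {A K p a : ℝ} (P : RbPar A K p a) (u : H) (v : V) : 0 ≤ rbB A K p a u v := by
  have hA0 : 0 < A := lt_of_lt_of_le (by positivity) P.hA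
  have hK1 : 1 ≤ K := by
    have := P.hK; have := P.ha0; have := P.ha1
    by_contra h
    nlinarith
  unfold rbB rbPhi
  set X := ‖u‖ ^ 2 + 1
  set Y := ‖v‖ ^ 2 + 1
  have hX : 0 < X := by positivity
  have hY : 0 < Y := by positivity
  have h1 : Y ^ ((1 + 3 * a) / 2) / (X + Y ^ a) ≤ Y ^ ((1 + a) / 2) := by
    rw [div_le_iff₀ (by positivity)]
    have : Y ^ ((1 + 3 * a) / 2) = Y ^ ((1 + a) / 2) * Y ^ a := by
      rw [← Real.rpow_add hY]; congr 1; ring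
    rw [this]
    gcongr
    linarith
  have h2 : Y ^ ((1 + a) / 2) ≤ K * Y ^ ((1 + a) / 2) := by
    have : 0 ≤ Y ^ ((1 + a) / 2) := by positivity
    nlinarith
  have h3 : 0 ≤ A * X ^ (p / 2) := by positivity
  linarith

lemma rb_pow_add_one (x s : ℝ) (hx : 0 ≤ x) (hs : 0 ≤ s) :
    (x ^ 2 + 1) ^ (s / 2) ≤ 2 ^ (s / 2) * (x ^ s + 1) := by
  have hxs : (x ^ 2) ^ (s / 2) = x ^ s := by
    rw [← Real.rpow_natCast, ← Real.rpow_mul hx]; congr 1; push_cast; ring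
  have h0 : 0 ≤ x ^ s := by positivity
  rcases le_total (x ^ 2) 1 with h | h
  · calc (x ^ 2 + 1) ^ (s / 2) ≤ 2 ^ (s / 2) := by gcongr; linarith
      _ ≤ _ := le_mul_of_one_le_right (by positivity) (by linarith)
  · calc (x ^ 2 + 1) ^ (s / 2) ≤ (2 * x ^ 2) ^ (s / 2) := by gcongr; linarith
      _ = 2 ^ (s / 2) * x ^ s := by rw [Real.mul_rpow (by norm_num) (by positivity), hxs]
      _ ≤ _ := by gcongr; linarith

lemma rbB_upper {A K p a : ℝ} (P : RbPar A K p a) (u : H) (v : V) :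
    rbB A K p a u v ≤ A * 2 ^ (p / 2) * (‖u‖ ^ p + 1) + K * 2 ^ ((1 + a) / 2) * (‖v‖ ^ (1 + a) + 1) := by
  have hA0 : 0 < A := lt_of_lt_of_le (by positivity) P.hA
  have ha0 := P.ha0
  have hK0 : 0 ≤ K := by
    have := P.hK
    by_contra h
    nlinarith
  unfold rbB rbPhi
  have h1 := mul_le_mul_of_nonneg_left (rb_pow_add_one ‖u‖ p (norm_nonneg u) (by linarith [P.hp])) hA0.le
  have h2 := mul_le_mul_of_nonneg_left (rb_pow_add_one ‖v‖ (1 + a) (norm_nonneg v) (by linarith)) hK0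
  have h3 : 0 ≤ (‖v‖ ^ 2 + 1) ^ ((1 + 3 * a) / 2) / (‖u‖ ^ 2 + 1 + (‖v‖ ^ 2 + 1) ^ a) := by positivity
  linarith

lemma rbB_tendsto (A K p a : ℝ) {u : ℝ → H} {v : ℝ → V} {u0 : H} {v0 : V}
    {l : Filter ℝ} (hu : Filter.Tendsto u l (nhds u0)) (hv : Filter.Tendsto v l (nhds v0)) :
    Filter.Tendsto (fun t => rbB A K p a (u t) (v t)) l (nhds (rbB A K p a u0 v0)) := by
  unfold rbB rbPhi
  have hX := (hu.norm.pow 2).add_const 1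
  have hY := (hv.norm.pow 2).add_const 1
  have hX0 : ‖u0‖ ^ 2 + 1 ≠ 0 := by positivity
  have hY0 : ‖v0‖ ^ 2 + 1 ≠ 0 := by positivity
  have hD : ‖u0‖ ^ 2 + 1 + (‖v0‖ ^ 2 + 1) ^ a ≠ 0 := by positivity
  exact (((hX.rpow_const (Or.inl hX0)).const_mul A).add
    ((hY.rpow_const (Or.inl hY0)).const_mul K)).sub
    ((hY.rpow_const (Or.inl hY0)).div (hX.add (hY.rpow_const (Or.inl hY0))) hD)

end bell

lemma rb_convex_limit (f f' f'' : ℝ → ℝ) (L : ℝ) (h1 : ∀ t, HasDerivAt f (f' t) t)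
    (h2 : ∀ t, HasDerivAt f' (f'' t) t) (h3 : ∀ t, 0 ≤ f'' t)
    (hL : Filter.Tendsto f Filter.atTop (nhds L)) : L ≤ f 0 := by
  have hc : ConvexOn ℝ Set.univ f :=
    convexOn_of_hasDerivWithinAt2_nonneg convex_univ
      (fun t _ => (h1 t).continuousAt.continuousWithinAt)
      (fun t _ => (h1 t).hasDerivWithinAt) (fun t _ => (h2 t).hasDerivWithinAt) (fun t _ => h3 t)
  have hm : ∀ t : ℝ, f t ≤ 1 / 2 * f 0 + 1 / 2 * f (t * 2) := by
    intro t
    have := hc.2 (Set.mem_univ 0) (Set.mem_univ (t * 2)) (by norm_num : (0:ℝ) ≤ 1 / 2)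
      (by norm_num : (0:ℝ) ≤ 1 / 2) (by norm_num)
    simp only [smul_eq_mul, mul_zero, zero_add] at this
    have e : (1:ℝ) / 2 * (t * 2) = t := by ring
    rwa [e] at this
  have hL2 : Filter.Tendsto (fun t : ℝ => f (t * 2)) Filter.atTop (nhds L) :=
    hL.comp (Filter.tendsto_id.atTop_mul_const (by norm_num))
  have := le_of_tendsto_of_tendsto' hL ((hL2.const_mul (1 / 2)).const_add (1 / 2 * f 0)) hm
  linarith

section walsh
variable {n : ℕ}

lemma rb_flip_flip (i : Fin n) (ε : Fin n → Bool) : flipCoord i (flipCoord i ε) = ε := by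
  simp [flipCoord]

lemma rb_sum_flip {M : Type*} [AddCommMonoid M] (i : Fin n) (f : (Fin n → Bool) → M) :
    ∑ ε, f (flipCoord i ε) = ∑ ε, f ε :=
  Equiv.sum_comp (Function.Involutive.toPerm (flipCoord i) (rb_flip_flip i)) f

lemma rb_rad_not (b : Bool) : rad (!b) = - rad b := by cases b <;> simp [rad]

lemma rb_walsh_flip (i : Fin n) (A : Finset (Fin n)) (ε : Fin n → Bool) :
    walshChar A (flipCoord i ε) = (if i ∈ A then -1 else 1) * walshChar A ε := by
  unfold walshChar flipCoord
  have h : ∀ j, rad (Function.update ε i (!(ε i)) j) = (if j = i then -1 else 1) * rad (ε j) := by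
    intro j
    by_cases hj : j = i
    · subst hj; simp [rb_rad_not]
    · simp [hj]
  simp_rw [h, prod_mul_distrib]
  congr 1
  rw [prod_ite_eq']

lemma rb_walsh_orth (A B : Finset (Fin n)) :
    ∑ ε : Fin n → Bool, walshChar A ε * walshChar B ε = if A = B then 2 ^ n else 0 := by
  have h : ∀ ε : Fin n → Bool, walshChar A ε * walshChar B ε =
      ∏ i, (if i ∈ A then rad (ε i) else 1) * (if i ∈ B then rad (ε i) else 1) := by
    intro ε
    rw [prod_mul_distrib]
    simp [walshChar, prod_ite_mem]
  simp_rw [h]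
  rw [← Fintype.prod_sum (fun i b => (if i ∈ A then rad b else 1) * (if i ∈ B then rad b else 1))]
  have h2 : ∀ i, ∑ b, (if i ∈ A then rad b else 1) * (if i ∈ B then rad b else 1) =
      if (i ∈ A ↔ i ∈ B) then (2:ℝ) else 0 := by
    intro i
    by_cases hA : i ∈ A <;> by_cases hB : i ∈ B <;> simp [hA, hB, rad] <;> norm_num
  simp_rw [h2]
  by_cases hAB : A = B
  · subst hAB; simp
  · rw [if_neg hAB]
    obtain ⟨i, hi⟩ : ∃ i, ¬ (i ∈ A ↔ i ∈ B) := by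
      by_contra hh
      push Not at hh
      exact hAB (Finset.ext hh)
    exact prod_eq_zero (mem_univ i) (if_neg hi)

lemma rb_walsh_complete (ε η : Fin n → Bool) :
    ∑ A : Finset (Fin n), walshChar A ε * walshChar A η = if ε = η then 2 ^ n else 0 := by
  have h : ∀ A : Finset (Fin n), walshChar A ε * walshChar A η = ∏ i ∈ A, rad (ε i) * rad (η i) := by
    intro A; simp [walshChar, prod_mul_distrib]
  simp_rw [h]
  rw [← Finset.powerset_univ, ← Finset.prod_one_add]
  by_cases he : ε = η
  · subst he
    have : ∀ i, 1 + rad (ε i) * rad (ε i) = 2 := by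
      intro i; cases ε i <;> simp [rad] <;> norm_num
    simp [this]
  · rw [if_neg he]
    obtain ⟨i, hi⟩ := Function.ne_iff.mp he
    refine prod_eq_zero (mem_univ i) ?_
    revert hi
    cases ε i <;> cases η i <;> simp [rad]

variable {X : Type*} [AddCommGroup X] [Module ℝ X]

/-- Synthesis of a function from its Walsh coefficients. -/
def rbSyn (c : Finset (Fin n) → X) (ε : Fin n → Bool) : X := ∑ A, walshChar A ε • c A

lemma rb_inversion (f : (Fin n → Bool) → X) (ε : Fin n → Bool) : rbSyn (wcoef f) ε = f ε := by
  unfold rbSyn wcoef cubeAvg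
  simp_rw [smul_sum, smul_smul]
  rw [sum_comm]
  have : ∀ η : Fin n → Bool, ∑ A : Finset (Fin n),
      (walshChar A ε * ((2 ^ n : ℝ)⁻¹ * walshChar A η)) • f η =
      if ε = η then f η else 0 := by
    intro η
    rw [← sum_smul]
    have e : ∑ A : Finset (Fin n), (walshChar A ε * ((2 ^ n : ℝ)⁻¹ * walshChar A η)) =
      (2 ^ n : ℝ)⁻¹ * ∑ A : Finset (Fin n), walshChar A ε * walshChar A η := by
      rw [mul_sum]; exact sum_congr rfl fun A _ => by ring
    rw [e, rb_walsh_complete]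
    split_ifs <;> simp
  simp_rw [this]
  simp

lemma rb_wcoef_syn (c : Finset (Fin n) → X) (A : Finset (Fin n)) : wcoef (rbSyn c) A = c A := by
  unfold rbSyn wcoef cubeAvg
  simp_rw [smul_sum, smul_smul]
  rw [sum_comm]
  have : ∀ B : Finset (Fin n), ∑ ε : Fin n → Bool,
      ((2 ^ n : ℝ)⁻¹ * (walshChar A ε * walshChar B ε)) • c B = if A = B then c B else 0 := by
    intro B
    rw [← sum_smul, ← mul_sum, rb_walsh_orth]
    split_ifs <;> simp
  simp_rw [this]
  simp

lemma rb_Dop_syn (i : Fin n) (c : Finset (Fin n) → X) :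
    Dop i (rbSyn c) = rbSyn (fun A => if i ∈ A then c A else 0) := by
  funext ε
  unfold Dop rbSyn
  rw [← sum_sub_distrib, smul_sum]
  refine sum_congr rfl fun A _ => ?_
  rw [rb_walsh_flip]
  by_cases h : i ∈ A
  · simp only [if_pos h]
    module
  · simp only [if_neg h]
    module

lemma rb_wcoef_Dop (i : Fin n) (f : (Fin n → Bool) → X) (A : Finset (Fin n)) :
    wcoef (Dop i f) A = if i ∈ A then wcoef f A else 0 := by
  have : f = rbSyn (wcoef f) := funext fun ε => (rb_inversion f ε).symm
  conv_lhs => rw [this, rb_Dop_syn, rb_wcoef_syn]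

lemma rb_sum_Dop_syn (c : Finset (Fin n) → X) (ε : Fin n → Bool) :
    ∑ i, Dop i (rbSyn c) ε = rbSyn (fun A => (A.card : ℝ) • c A) ε := by
  simp_rw [rb_Dop_syn]
  unfold rbSyn
  rw [sum_comm]
  refine sum_congr rfl fun A _ => ?_
  rw [← smul_sum]
  congr 1
  rw [sum_ite_mem]
  simp [Nat.cast_smul_eq_nsmul]

end walsh

section ip
variable {n : ℕ} {V : Type*} [NormedAddCommGroup V] [InnerProductSpace ℝ V]

lemma rb_parseval (c d : Finset (Fin n) → V) :
    ∑ ε, inner ℝ (rbSyn c ε) (rbSyn d ε) = 2 ^ n * ∑ A, inner ℝ (c A) (d A) := by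
  unfold rbSyn
  simp_rw [sum_inner, inner_sum, real_inner_smul_left, real_inner_smul_right]
  rw [sum_comm, mul_sum]
  refine sum_congr rfl fun A _ => ?_
  rw [sum_comm]
  have : ∀ B : Finset (Fin n), ∑ ε : Fin n → Bool, walshChar A ε * (walshChar B ε * inner ℝ (c A) (d B))
      = if A = B then 2 ^ n * inner ℝ (c A) (d B) else 0 := by
    intro B
    simp_rw [← mul_assoc]
    rw [← sum_mul, rb_walsh_orth]
    split_ifs <;> simp
  simp_rw [this]
  simp

/-- Poisson extension. -/
def rbPoi (c : Finset (Fin n) → V) (t : ℝ) (ε : Fin n → Bool) : V :=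
  rbSyn (fun A => Real.exp (-(t * √(A.card : ℝ))) • c A) ε

lemma rbPoi_deriv (c : Finset (Fin n) → V) (t : ℝ) (ε : Fin n → Bool) :
    HasDerivAt (fun s => rbPoi c s ε) (rbPoi (fun A => (-√(A.card : ℝ)) • c A) t ε) t := by
  unfold rbPoi rbSyn
  refine HasDerivAt.fun_sum fun A _ => ?_
  have h : HasDerivAt (fun s : ℝ => Real.exp (-(s * √(A.card : ℝ))))
      (Real.exp (-(t * √(A.card : ℝ))) * (-√(A.card : ℝ))) t := by
    have := (((hasDerivAt_id t).mul_const (√(A.card : ℝ))).neg).exp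
    simpa using this
  refine ((h.smul_const (c A)).const_smul (walshChar A ε)).congr_deriv ?_
  simp [smul_smul]

lemma rbPoi_deriv2 (c : Finset (Fin n) → V) (t : ℝ) (ε : Fin n → Bool) :
    HasDerivAt (fun s => rbPoi (fun A => (-√(A.card : ℝ)) • c A) s ε)
      (∑ i, Dop i (rbPoi c t) ε) t := by
  refine (rbPoi_deriv _ t ε).congr_deriv ?_
  have e : rbPoi c t = rbSyn (fun A => Real.exp (-(t * √(A.card : ℝ))) • c A) := rfl
  rw [e, rb_sum_Dop_syn]
  unfold rbPoi
  congr 1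
  funext A
  simp only [smul_smul]
  congr 1
  rw [neg_mul_neg, Real.mul_self_sqrt (by positivity)]
  ring

lemma rb_exp_tendsto (A : Finset (Fin n)) (m : ℝ) (hm : 0 < m) :
    Filter.Tendsto (fun t : ℝ => Real.exp (-(m * (t * √(A.card : ℝ))))) Filter.atTop
      (nhds (if A = ∅ then 1 else 0)) := by
  by_cases hA : A = ∅
  · subst hA; simp
  · rw [if_neg hA]
    have hc : 0 < √(A.card : ℝ) := by
      rw [Real.sqrt_pos]; exact_mod_cast Finset.card_pos.mpr (Finset.nonempty_iff_ne_empty.mpr hA)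
    exact Real.tendsto_exp_neg_atTop_nhds_zero.comp
      ((Filter.tendsto_id.atTop_mul_const hc).const_mul_atTop hm)

lemma rbPoi_tendsto (c : Finset (Fin n) → V) (ε : Fin n → Bool) :
    ∃ l, Filter.Tendsto (fun t => rbPoi c t ε) Filter.atTop (nhds l) := by
  unfold rbPoi rbSyn
  refine ⟨∑ A : Finset (Fin n), walshChar A ε • ((if A = ∅ then (1:ℝ) else 0) • c A),
    tendsto_finsetSum _ fun A _ => ?_⟩
  have := rb_exp_tendsto A 1 one_pos
  simp only [one_mul] at this
  exact (this.smul_const (c A)).const_smul (walshChar A ε)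

lemma rbGrad_sum (A K p a : ℝ) {H : Type*} [NormedAddCommGroup H] [InnerProductSpace ℝ H]
    (u : H) (v : V) (z : Fin n → H) (e : Fin n → V) :
    rbGrad A K p a u v (∑ i, z i) (∑ i, e i) = ∑ i, rbGrad A K p a u v (z i) (e i) := by
  simp only [rbGrad, inner_sum, mul_sum, sum_add_distrib]

lemma rbGrad_smul (A K p a : ℝ) {H : Type*} [NormedAddCommGroup H] [InnerProductSpace ℝ H]
    (u : H) (v : V) (r : ℝ) (z : H) (e : V) :
    rbGrad A K p a u v (r • z) (r • e) = r * rbGrad A K p a u v z e := by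
  simp only [rbGrad, real_inner_smul_right]; ring

lemma rb_main_step {A K p a : ℝ} (P : RbPar A K p a)
    (u u1 : (Fin n → Bool) → PiLp 2 (fun _ : Fin n => V)) (v v1 : (Fin n → Bool) → V)
    (hodd : ∀ i ε, ‖u1 (flipCoord i ε) i‖ = ‖u1 ε i‖) :
    -∑ ε, ∑ i, inner ℝ (u1 ε i) (Dop i v ε) ≤
      ∑ ε, (rbH2 A K p a (u ε) (v ε) (u1 ε) (v1 ε) +
        rbGrad A K p a (u ε) (v ε) (∑ i, Dop i u ε) (∑ i, Dop i v ε)) := by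
  set Y : (Fin n → Bool) → ℝ := fun ε => ‖v ε‖ ^ 2 + 1 with hY
  have hY0 : ∀ ε, 0 < Y ε := fun ε => by positivity
  set s := (1 - a) / 2 with hs
  have hs0 : 0 ≤ s := by have := P.ha1; simp only [hs]; linarith
  have hgrad : ∀ ε i, 1 / 2 * (rbB A K p a (u ε) (v ε) -
      rbB A K p a (u (flipCoord i ε)) (v (flipCoord i ε))) +
      (max (Y ε) (Y (flipCoord i ε))) ^ (-s) * ‖Dop i v ε‖ ^ 2 ≤
      rbGrad A K p a (u ε) (v ε) (Dop i u ε) (Dop i v ε) := by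
    intro ε i
    have ht := rbB_tangent P (u ε) (u (flipCoord i ε)) (v ε) (v (flipCoord i ε))
    have e1 : Dop i u ε = (-(2:ℝ)⁻¹) • (u (flipCoord i ε) - u ε) := by
      unfold Dop; module
    have e2 : Dop i v ε = (-(2:ℝ)⁻¹) • (v (flipCoord i ε) - v ε) := by
      unfold Dop; module
    rw [e1, e2, rbGrad_smul, norm_smul, mul_pow]
    have e3 : ‖(-(2:ℝ)⁻¹)‖ ^ 2 = 1 / 4 := by norm_num
    rw [e3]
    simp only [hY, hs]
    linarith
  have hcs : ∀ ε i, -inner ℝ (u1 ε i) (Dop i v ε) ≤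
      1 / 4 * (Y ε ^ s + Y (flipCoord i ε) ^ s) * ‖u1 ε i‖ ^ 2 +
      (max (Y ε) (Y (flipCoord i ε))) ^ (-s) * ‖Dop i v ε‖ ^ 2 := by
    intro ε i
    have h0 : 0 < max (Y ε) (Y (flipCoord i ε)) := lt_max_of_lt_left (hY0 ε)
    have h1 : (max (Y ε) (Y (flipCoord i ε))) ^ s ≤ Y ε ^ s + Y (flipCoord i ε) ^ s := by
      have g1 : 0 ≤ Y ε ^ s := (Real.rpow_pos_of_pos (hY0 _) _).le
      have g2 : 0 ≤ Y (flipCoord i ε) ^ s := (Real.rpow_pos_of_pos (hY0 _) _).le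
      rcases max_choice (Y ε) (Y (flipCoord i ε)) with h | h <;> rw [h] <;> linarith
    have h2 : -inner ℝ (u1 ε i) (Dop i v ε) ≤ ‖u1 ε i‖ * ‖Dop i v ε‖ :=
      (neg_le_abs _).trans (abs_real_inner_le_norm _ _)
    have h3 := mul_le_mul_of_nonneg_right h1 (sq_nonneg ‖u1 ε i‖)
    rw [Real.rpow_neg h0.le]
    have hm : 0 < (max (Y ε) (Y (flipCoord i ε))) ^ s := Real.rpow_pos_of_pos h0 _
    generalize (max (Y ε) (Y (flipCoord i ε))) ^ s = m at *
    have h4 : ‖u1 ε i‖ * ‖Dop i v ε‖ ≤ 1 / 4 * (m * ‖u1 ε i‖ ^ 2) + m⁻¹ * ‖Dop i v ε‖ ^ 2 := by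
      have : 1 / 4 * (m * ‖u1 ε i‖ ^ 2) + m⁻¹ * ‖Dop i v ε‖ ^ 2 - ‖u1 ε i‖ * ‖Dop i v ε‖ =
        m⁻¹ * (1 / 2 * m * ‖u1 ε i‖ - ‖Dop i v ε‖) ^ 2 := by field_simp; ring
      have h5 : 0 ≤ m⁻¹ * (1 / 2 * m * ‖u1 ε i‖ - ‖Dop i v ε‖) ^ 2 := by positivity
      linarith
    linarith
  have hflip : ∀ i, ∑ ε, 1 / 4 * (Y ε ^ s + Y (flipCoord i ε) ^ s) * ‖u1 ε i‖ ^ 2 =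
      ∑ ε, 1 / 2 * Y ε ^ s * ‖u1 ε i‖ ^ 2 := by
    intro i
    have h1 : ∑ ε, 1 / 4 * Y (flipCoord i ε) ^ s * ‖u1 ε i‖ ^ 2 =
        ∑ ε, 1 / 4 * Y ε ^ s * ‖u1 ε i‖ ^ 2 := by
      rw [← rb_sum_flip i (fun ε => 1 / 4 * Y ε ^ s * ‖u1 ε i‖ ^ 2)]
      exact sum_congr rfl fun ε _ => by rw [hodd]
    have h2 : ∀ ε, 1 / 4 * (Y ε ^ s + Y (flipCoord i ε) ^ s) * ‖u1 ε i‖ ^ 2 =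
      1 / 4 * Y ε ^ s * ‖u1 ε i‖ ^ 2 + 1 / 4 * Y (flipCoord i ε) ^ s * ‖u1 ε i‖ ^ 2 :=
      fun ε => by ring
    simp_rw [h2]
    rw [sum_add_distrib, h1, ← sum_add_distrib]
    exact sum_congr rfl fun ε _ => by ring
  have hB : ∀ i, ∑ ε, 1 / 2 * (rbB A K p a (u ε) (v ε) -
      rbB A K p a (u (flipCoord i ε)) (v (flipCoord i ε))) = 0 := by
    intro i
    rw [← mul_sum, sum_sub_distrib, rb_sum_flip i (fun ε => rbB A K p a (u ε) (v ε))]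
    simp
  calc -∑ ε, ∑ i, inner ℝ (u1 ε i) (Dop i v ε)
      = ∑ i, ∑ ε, -inner ℝ (u1 ε i) (Dop i v ε) := by
        rw [sum_comm]; simp only [sum_neg_distrib]
    _ ≤ ∑ i, ∑ ε, (1 / 4 * (Y ε ^ s + Y (flipCoord i ε) ^ s) * ‖u1 ε i‖ ^ 2 +
      (max (Y ε) (Y (flipCoord i ε))) ^ (-s) * ‖Dop i v ε‖ ^ 2) :=
        sum_le_sum fun i _ => sum_le_sum fun ε _ => hcs ε i
    _ = ∑ i, ∑ ε, (1 / 2 * Y ε ^ s * ‖u1 ε i‖ ^ 2 + (1 / 2 * (rbB A K p a (u ε) (v ε) -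
      rbB A K p a (u (flipCoord i ε)) (v (flipCoord i ε))) +
      (max (Y ε) (Y (flipCoord i ε))) ^ (-s) * ‖Dop i v ε‖ ^ 2)) := by
        refine sum_congr rfl fun i _ => ?_
        rw [sum_add_distrib, sum_add_distrib, sum_add_distrib, hflip, hB, zero_add]
    _ ≤ ∑ i, ∑ ε, (1 / 2 * Y ε ^ s * ‖u1 ε i‖ ^ 2 +
          rbGrad A K p a (u ε) (v ε) (Dop i u ε) (Dop i v ε)) :=
        sum_le_sum fun i _ => sum_le_sum fun ε _ => by linarith [hgrad ε i]
    _ = ∑ ε, (1 / 2 * Y ε ^ s * ‖u1 ε‖ ^ 2 +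
        rbGrad A K p a (u ε) (v ε) (∑ i, Dop i u ε) (∑ i, Dop i v ε)) := by
        rw [sum_comm]
        refine sum_congr rfl fun ε _ => ?_
        rw [sum_add_distrib, rbGrad_sum, ← mul_sum, PiLp.norm_sq_eq_of_L2]
    _ ≤ _ := by
        refine sum_le_sum fun ε _ => ?_
        have h1 := rbH2_lower P (u ε) (v ε) (u1 ε) (v1 ε)
        have h2 : 0 ≤ (‖v ε‖ ^ 2 + 1) ^ (-((1 - a) / 2)) * ‖v1 ε‖ ^ 2 := by positivity
        simp only [hY, hs]
        linarith

end ip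

section bilin
variable {n : ℕ} {V : Type*} [NormedAddCommGroup V] [InnerProductSpace ℝ V]

lemma rbSyn_apply (c : Finset (Fin n) → PiLp 2 (fun _ : Fin n => V)) (ε : Fin n → Bool)
    (i : Fin n) : rbSyn c ε i = rbSyn (fun A => c A i) ε := by
  simp [rbSyn, PiLp.smul_apply]

lemma rb_bilin_coef {A K p a : ℝ} (P : RbPar A K p a)
    (c : Finset (Fin n) → PiLp 2 (fun _ : Fin n => V)) (d : Finset (Fin n) → V)
    (hc : ∀ B i, i ∉ B → c B i = 0) :
    2 ^ n * ∑ B : Finset (Fin n), (√(B.card : ℝ))⁻¹ * ∑ i, inner ℝ (c B i) (d B) ≤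
      4 * ∑ ε, rbB A K p a (rbSyn c ε) (rbSyn d ε) := by
  set κ : Finset (Fin n) → ℝ := fun B => -(1 / 4) * 2 ^ n * (√(B.card : ℝ))⁻¹ *
    ∑ i, inner ℝ (c B i) (d B) with hκ
  set ex : Finset (Fin n) → ℝ → ℝ := fun B t => Real.exp (-(2 * (t * √(B.card : ℝ)))) with hex
  have hexd : ∀ B t, HasDerivAt (ex B) (ex B t * (-(2 * √(B.card : ℝ)))) t := by
    intro B t
    have := ((((hasDerivAt_id t).mul_const (√(B.card : ℝ))).const_mul 2).neg).exp
    simpa [hex] using this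
  have hk1 : ∀ t, HasDerivAt (fun s => ∑ B, κ B * ex B s)
      (∑ B, κ B * (ex B t * (-(2 * √(B.card : ℝ))))) t := fun t =>
    HasDerivAt.fun_sum fun B _ => (hexd B t).const_mul (κ B)
  have hk2 : ∀ t, HasDerivAt (fun s => ∑ B, κ B * (ex B s * (-(2 * √(B.card : ℝ)))))
      (∑ B, κ B * (ex B t * (-(2 * √(B.card : ℝ))) * (-(2 * √(B.card : ℝ))))) t := fun t =>
    HasDerivAt.fun_sum fun B _ => ((hexd B t).mul_const _).const_mul (κ B)
  set c1 : Finset (Fin n) → PiLp 2 (fun _ : Fin n => V) := fun B => (-√(B.card : ℝ)) • c B with hc1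
  set d1 : Finset (Fin n) → V := fun B => (-√(B.card : ℝ)) • d B with hd1
  have hb1 : ∀ t, HasDerivAt (fun s => ∑ ε, rbB A K p a (rbPoi c s ε) (rbPoi d s ε))
      (∑ ε, rbGrad A K p a (rbPoi c t ε) (rbPoi d t ε) (rbPoi c1 t ε) (rbPoi d1 t ε)) t := fun t =>
    HasDerivAt.fun_sum fun ε _ => rbB_deriv A K p a (rbPoi_deriv c t ε) (rbPoi_deriv d t ε)
  have hb2 : ∀ t, HasDerivAt
      (fun t => ∑ ε, rbGrad A K p a (rbPoi c t ε) (rbPoi d t ε) (rbPoi c1 t ε) (rbPoi d1 t ε))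
      (∑ ε, (rbH2 A K p a (rbPoi c t ε) (rbPoi d t ε) (rbPoi c1 t ε) (rbPoi d1 t ε) +
        rbGrad A K p a (rbPoi c t ε) (rbPoi d t ε) (∑ i, Dop i (rbPoi c t) ε)
          (∑ i, Dop i (rbPoi d t) ε))) t := fun t =>
    HasDerivAt.fun_sum fun ε _ => rbB_deriv2 A K p a (u1 := fun t => rbPoi c1 t ε)
      (v1 := fun t => rbPoi d1 t ε) (rbPoi_deriv c t ε) (rbPoi_deriv d t ε)
      (rbPoi_deriv2 c t ε) (rbPoi_deriv2 d t ε)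
  have htheta : ∀ t, ∑ ε, ∑ i, inner ℝ (rbPoi c1 t ε i) (Dop i (rbPoi d t) ε) =
      ∑ B, κ B * (ex B t * (-(2 * √(B.card : ℝ))) * (-(2 * √(B.card : ℝ)))) := by
    intro t
    rw [sum_comm]
    have h1 : ∀ i, ∑ ε, inner ℝ (rbPoi c1 t ε i) (Dop i (rbPoi d t) ε) =
        ∑ B, -(2 ^ n * √(B.card : ℝ) * ex B t * inner ℝ (c B i) (d B)) := by
      intro i
      have e : rbPoi d t = rbSyn (fun A => Real.exp (-(t * √(A.card : ℝ))) • d A) := rfl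
      rw [e, rb_Dop_syn]
      unfold rbPoi
      simp_rw [rbSyn_apply]
      rw [rb_parseval, mul_sum]
      refine sum_congr rfl fun B _ => ?_
      by_cases hi : i ∈ B
      · rw [if_pos hi]
        simp only [hc1, PiLp.smul_apply, smul_smul, real_inner_smul_left, real_inner_smul_right, hex]
        have : Real.exp (-(2 * (t * √(B.card : ℝ)))) =
          Real.exp (-(t * √(B.card : ℝ))) * Real.exp (-(t * √(B.card : ℝ))) := by
          rw [← Real.exp_add]; congr 1; ring
        rw [this]
        ring
      · rw [if_neg hi, hc B i hi]; simp
    simp_rw [h1]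
    rw [sum_comm]
    refine sum_congr rfl fun B _ => ?_
    have h2 : (√(B.card : ℝ))⁻¹ * √(B.card : ℝ) * √(B.card : ℝ) = √(B.card : ℝ) := by
      by_cases h0 : √(B.card : ℝ) = 0
      · simp [h0]
      · field_simp
    have h3 : κ B * (ex B t * (-(2 * √(B.card : ℝ))) * (-(2 * √(B.card : ℝ)))) =
       -(2 ^ n * ((√(B.card : ℝ))⁻¹ * √(B.card : ℝ) * √(B.card : ℝ)) * ex B t *
        ∑ i, inner ℝ (c B i) (d B)) := by simp only [hκ]; ring
    rw [h3, h2, mul_sum, sum_neg_distrib]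
  have hodd : ∀ t i ε, ‖rbPoi c1 t (flipCoord i ε) i‖ = ‖rbPoi c1 t ε i‖ := by
    intro t i ε
    unfold rbPoi
    rw [rbSyn_apply, rbSyn_apply, ← norm_neg]
    congr 1
    unfold rbSyn
    rw [← sum_neg_distrib]
    refine sum_congr rfl fun B _ => ?_
    rw [rb_walsh_flip]
    by_cases hi : i ∈ B
    · rw [if_pos hi]; module
    · simp [hc1, hc B i hi]
  have hlimb : ∃ L, 0 ≤ L ∧ Filter.Tendsto (fun s => ∑ ε, rbB A K p a (rbPoi c s ε) (rbPoi d s ε))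
      Filter.atTop (nhds L) := by
    choose lc hlc using rbPoi_tendsto c
    choose ld hld using rbPoi_tendsto d
    exact ⟨∑ ε, rbB A K p a (lc ε) (ld ε), sum_nonneg fun ε _ => rbB_nonneg P _ _,
      tendsto_finsetSum _ fun ε _ => rbB_tendsto A K p a (hlc ε) (hld ε)⟩
  have hlimk : Filter.Tendsto (fun s => ∑ B, κ B * ex B s) Filter.atTop (nhds 0) := by
    have : ∑ B, κ B * (if B = ∅ then (1:ℝ) else 0) = 0 := by
      refine sum_eq_zero fun B _ => ?_
      by_cases hB : B = ∅
      · subst hB; simp [hκ]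
      · simp [hB]
    rw [← this]
    exact tendsto_finsetSum _ fun B _ => (rb_exp_tendsto B 2 two_pos).const_mul (κ B)
  obtain ⟨L, hL0, hL⟩ := hlimb
  have key := rb_convex_limit _ _ _ _ (fun t => (hb1 t).fun_add (hk1 t))
    (fun t => (hb2 t).fun_add (hk2 t)) (fun t => by
      have := rb_main_step P (rbPoi c t) (rbPoi c1 t) (rbPoi d t) (rbPoi d1 t) (hodd t)
      rw [htheta] at this
      linarith) (hL.add hlimk)
  have hp0 : ∀ {W : Type _} [NormedAddCommGroup W] [InnerProductSpace ℝ W]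
     (c : Finset (Fin n) → W), rbPoi c 0 = rbSyn c := by
    intro W _ _ c
    funext ε
    simp [rbPoi]
  have hp0' : ∀ {W : Type _} [NormedAddCommGroup W] [InnerProductSpace ℝ W]
     (c : Finset (Fin n) → W), rbPoi c 0 = rbSyn c := by
    intro W _ _ c
    funext ε
    simp [rbPoi]
  rw [hp0 c, hp0' d] at key
  have hk0 : ∑ B, κ B * ex B 0 = -(1 / 4) * (2 ^ n * ∑ B : Finset (Fin n), (√(B.card : ℝ))⁻¹ * ∑ i, inner ℝ (c B i) (d B)) := by
    rw [mul_sum, mul_sum]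
    refine sum_congr rfl fun B _ => ?_
    simp only [hκ, hex]
    simp
    ring
  rw [hk0] at key
  linarith

lemma rb_lapPow_eq (f : (Fin n → Bool) → V) :
    lapPow (-(1 / 2)) f = rbSyn (fun B => (√(B.card : ℝ))⁻¹ • wcoef f B) := by
  funext ε
  unfold lapPow rbSyn
  rw [sum_filter]
  refine sum_congr rfl fun B _ => ?_
  by_cases hB : B = ∅
  · subst hB; simp
  · rw [if_pos hB, Real.rpow_neg (by positivity), ← Real.sqrt_eq_rpow, smul_smul, mul_comm]

lemma rb_bilin {A K p a : ℝ} (P : RbPar A K p a)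
    (F : Fin n → (Fin n → Bool) → V) (G : (Fin n → Bool) → V) :
    ∑ ε, inner ℝ (∑ i, lapPow (-(1 / 2)) (Dop i (F i)) ε) (G ε) ≤
      4 * ∑ ε, (A * 2 ^ (p / 2) * ((∑ i, ‖Dop i (F i) ε‖ ^ 2) ^ (p / 2) + 1)
        + K * 2 ^ ((1 + a) / 2) * (‖G ε‖ ^ (1 + a) + 1)) := by
  set c : Finset (Fin n) → PiLp 2 (fun _ : Fin n => V) :=
    fun B => WithLp.toLp 2 (fun i => wcoef (Dop i (F i)) B) with hc
  have h := rb_bilin_coef P c (wcoef G) (fun B i hi => by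
    simp only [hc]
    rw [rb_wcoef_Dop, if_neg hi])
  have hl : ∑ ε, inner ℝ (∑ i, lapPow (-(1 / 2)) (Dop i (F i)) ε) (G ε) =
      2 ^ n * ∑ B : Finset (Fin n), (√(B.card : ℝ))⁻¹ * ∑ i, inner ℝ (c B i) (wcoef G B) := by
    simp_rw [sum_inner]
    rw [sum_comm]
    have : ∀ i, ∑ ε, inner ℝ (lapPow (-(1 / 2)) (Dop i (F i)) ε) (G ε) =
       2 ^ n * ∑ B : Finset (Fin n), (√(B.card : ℝ))⁻¹ * inner ℝ (c B i) (wcoef G B) := by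
      intro i
      have hG : G = rbSyn (wcoef G) := funext fun ε => (rb_inversion G ε).symm
      rw [rb_lapPow_eq]
      conv_lhs => rw [hG]
      rw [rb_parseval]
      simp_rw [real_inner_smul_left]
      rfl
    simp_rw [this]
    rw [← mul_sum, sum_comm]
    simp_rw [mul_sum]
  rw [hl]
  refine h.trans ?_
  gcongr with ε _
  refine (rbB_upper P _ _).trans (le_of_eq ?_)
  have h2 : ‖rbSyn c ε‖ ^ 2 = ∑ i, ‖Dop i (F i) ε‖ ^ 2 := by
    rw [PiLp.norm_sq_eq_of_L2]
    refine sum_congr rfl fun i _ => ?_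
    rw [rbSyn_apply]
    have := rb_inversion (Dop i (F i)) ε
    rw [← this]
  have h3 : ‖rbSyn c ε‖ ^ p = (∑ i, ‖Dop i (F i) ε‖ ^ 2) ^ (p / 2) := by
    rw [← h2, ← Real.rpow_natCast, ← Real.rpow_mul (norm_nonneg _)]
    congr 1
    push_cast
    ring
  rw [rb_inversion, h3]

lemma rb_khinchine {p : ℝ} (hp : 2 ≤ p) (x : Fin n → V) :
    (∑ i, ‖x i‖ ^ 2) ^ (p / 2) ≤ cubeAvg (fun δ : Fin n → Bool => ‖∑ i, rad (δ i) • x i‖ ^ p) := by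
  have h1 : ∑ δ : Fin n → Bool, ‖∑ i, rad (δ i) • x i‖ ^ 2 = 2 ^ n * ∑ i, ‖x i‖ ^ 2 := by
    have e : ∀ (i : Fin n) (δ : Fin n → Bool), rad (δ i) = walshChar {i} δ := by
      intro i δ; simp [walshChar]
    simp_rw [← real_inner_self_eq_norm_sq, sum_inner, inner_sum, real_inner_smul_left,
      real_inner_smul_right]
    rw [sum_comm, mul_sum]
    refine sum_congr rfl fun i _ => ?_
    rw [sum_comm]
    have : ∀ j, ∑ δ : Fin n → Bool, rad (δ i) * (rad (δ j) * inner ℝ (x i) (x j)) =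
        if i = j then 2 ^ n * inner ℝ (x i) (x j) else 0 := by
      intro j
      simp_rw [← mul_assoc, e]
      rw [← sum_mul, rb_walsh_orth]
      simp
    simp_rw [this]
    simp
  have hw : ∑ _δ : Fin n → Bool, ((2 ^ n : ℝ)⁻¹) = 1 := by simp
  have h2 := Real.rpow_arith_mean_le_arith_mean_rpow univ (fun _ : Fin n → Bool => (2 ^ n : ℝ)⁻¹)
    (fun δ => ‖∑ i, rad (δ i) • x i‖ ^ 2) (fun _ _ => by positivity) hw
    (fun _ _ => by positivity) (p := p / 2) (by linarith)
  rw [← mul_sum, ← mul_sum, h1, inv_mul_cancel_left₀ (by positivity)] at h2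
  refine h2.trans (le_of_eq ?_)
  unfold cubeAvg
  rw [smul_eq_mul]
  congr 1
  refine sum_congr rfl fun δ _ => ?_
  rw [← Real.rpow_natCast, ← Real.rpow_mul (norm_nonneg _)]
  congr 1
  push_cast
  ring
end bilin

lemma rb_opt {p q M AF B : ℝ} (hp : 1 < p) (hq : 1 < q) (hpq : 1 / p + 1 / q = 1) (hM : 0 ≤ M)
    (hA : 0 ≤ AF) (hB : 0 ≤ B)
    (h : ∀ l m : ℝ, 0 < l → 0 < m → l⁻¹ * m⁻¹ * B ≤ M * ((l ^ p)⁻¹ * AF + (m ^ q)⁻¹ * B + 2)) :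
    B ≤ (4 * M) ^ p * AF := by
  rcases hB.eq_or_lt with hB0 | hB0
  · rw [← hB0]; positivity
  have key : ∀ e > 0, B ≤ (4 * M) ^ p * (AF + e) := by
    intro e he
    have hA' : 0 < AF + e := by linarith
    set l := (AF + e) ^ (1 / p) with hl
    set m := B ^ (1 / q) with hm
    have hl0 : 0 < l := by positivity
    have hm0 : 0 < m := by positivity
    have hlp : l ^ p = AF + e := by
      rw [hl, ← Real.rpow_mul hA'.le, one_div_mul_cancel (by linarith), Real.rpow_one]
    have hmq : m ^ q = B := by
      rw [hm, ← Real.rpow_mul hB0.le, one_div_mul_cancel (by linarith), Real.rpow_one]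
    have h1 := h l m hl0 hm0
    rw [hlp, hmq, inv_mul_cancel₀ hB0.ne'] at h1
    have h2 : (AF + e)⁻¹ * AF ≤ 1 := by
      rw [inv_mul_le_iff₀ hA']; linarith
    have h3 : l⁻¹ * m⁻¹ * B ≤ 4 * M := by nlinarith
    have hBm : B = m * B ^ (1 / p) := by
      rw [hm, ← Real.rpow_add hB0, add_comm, hpq, Real.rpow_one]
    have h4 : B ^ (1 / p) ≤ 4 * M * l := by
      have : l⁻¹ * m⁻¹ * B = B ^ (1 / p) / l := by
        conv_lhs => rw [hBm]
        field_simp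
      rw [this, div_le_iff₀ hl0] at h3
      exact h3
    have h5 := Real.rpow_le_rpow (by positivity) h4 (by linarith : 0 ≤ p)
    rw [← Real.rpow_mul hB0.le, one_div_mul_cancel (by linarith), Real.rpow_one,
      Real.mul_rpow (by positivity) hl0.le, hlp] at h5
    exact h5
  have hlim : Filter.Tendsto (fun e : ℝ => (4 * M) ^ p * (AF + e)) (nhdsWithin 0 (Set.Ioi 0))
      (nhds ((4 * M) ^ p * (AF + 0))) := by
    refine Filter.Tendsto.mono_left ?_ nhdsWithin_le_nhds
    exact Continuous.tendsto (by fun_prop) 0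
  rw [add_zero] at hlim
  exact ge_of_tendsto hlim (by
    filter_upwards [self_mem_nhdsWithin] with e he using key e he)

section fin
variable {n : ℕ} {V : Type*} [NormedAddCommGroup V] [InnerProductSpace ℝ V]

lemma rb_Dop_smul (r : ℝ) (i : Fin n) (f : (Fin n → Bool) → V) :
    Dop i (r • f) = r • Dop i f := by
  funext ε
  simp only [Dop, Pi.smul_apply]
  module

lemma rb_lapPow_smul (r s : ℝ) (f : (Fin n → Bool) → V) :
    lapPow s (r • f) = r • lapPow s f := by
  have : ∀ A, wcoef (r • f) A = r • wcoef f A := by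
    intro A
    simp only [wcoef, cubeAvg, Pi.smul_apply, smul_sum]
    refine sum_congr rfl fun ε _ => ?_
    module
  funext ε
  simp only [lapPow, this, Pi.smul_apply, smul_sum]
  refine sum_congr rfl fun ε _ => ?_
  module

lemma rb_dual {A K p a : ℝ} (P : RbPar A K p a) (hp1 : (p - 1) * (1 + a) = p)
    (F : Fin n → (Fin n → Bool) → V) :
    cubeAvg (fun ε => ‖∑ i, lapPow (-(1 / 2)) (Dop i (F i)) ε‖ ^ p) ≤
      (4 * (4 * (A * 2 ^ (p / 2) + K * 2 ^ ((1 + a) / 2)))) ^ p *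
        cubeAvg (fun ε => (∑ i, ‖Dop i (F i) ε‖ ^ 2) ^ (p / 2)) := by
  have hp := P.hp
  have ha := P.ha0
  have hA0 : 0 ≤ A := le_trans (by positivity) P.hA
  have hK0 : 0 ≤ K := by
    have := P.hK
    by_contra hn
    nlinarith
  set f : (Fin n → Bool) → V := fun ε => ∑ i, lapPow (-(1 / 2)) (Dop i (F i)) ε with hf
  set α := A * 2 ^ (p / 2) with hα
  set β := K * 2 ^ ((1 + a) / 2) with hβ
  have hα0 : 0 ≤ α := by positivity
  have hβ0 : 0 ≤ β := by positivity
  refine rb_opt (q := 1 + a) (by linarith) (by linarith) ?_ (by positivity) ?_ ?_ ?_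
  · have : p - 1 ≠ 0 := by linarith
    field_simp
    linarith
  · unfold cubeAvg; rw [smul_eq_mul]; exact mul_nonneg (by positivity) (sum_nonneg fun _ _ => by positivity)
  · unfold cubeAvg; rw [smul_eq_mul]; exact mul_nonneg (by positivity) (sum_nonneg fun _ _ => by positivity)
  intro l m hl hm
  have h := rb_bilin P (fun i => l⁻¹ • F i) (fun ε => m⁻¹ • (‖f ε‖ ^ (p - 2) • f ε))
  have e1 : ∀ ε, inner ℝ (∑ i, lapPow (-(1 / 2)) (Dop i (l⁻¹ • F i)) ε)
      (m⁻¹ • (‖f ε‖ ^ (p - 2) • f ε)) = l⁻¹ * m⁻¹ * ‖f ε‖ ^ p := by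
    intro ε
    have : ∑ i, lapPow (-(1 / 2)) (Dop i (l⁻¹ • F i)) ε = l⁻¹ • f ε := by
      simp only [rb_Dop_smul, rb_lapPow_smul, Pi.smul_apply, hf, smul_sum]
    rw [this, real_inner_smul_left, real_inner_smul_right, real_inner_smul_right,
      real_inner_self_eq_norm_sq]
    rcases (norm_nonneg (f ε)).eq_or_lt with h0 | h0
    · rw [← h0, Real.zero_rpow (by linarith : p ≠ 0)]; simp
    · have : ‖f ε‖ ^ p = ‖f ε‖ ^ (p - 2) * ‖f ε‖ ^ 2 := by
        rw [← Real.rpow_natCast, ← Real.rpow_add h0]; congr 1; push_cast; ring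
      rw [this]; ring
  have e2 : ∀ ε, (∑ i, ‖Dop i (l⁻¹ • F i) ε‖ ^ 2) ^ (p / 2) =
      (l ^ p)⁻¹ * (∑ i, ‖Dop i (F i) ε‖ ^ 2) ^ (p / 2) := by
    intro ε
    have : ∑ i, ‖Dop i (l⁻¹ • F i) ε‖ ^ 2 = (l ^ (2:ℝ))⁻¹ * ∑ i, ‖Dop i (F i) ε‖ ^ 2 := by
      rw [mul_sum]
      refine sum_congr rfl fun i _ => ?_
      rw [rb_Dop_smul, Pi.smul_apply, norm_smul, mul_pow, Real.norm_of_nonneg (by positivity)]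
      norm_num
    rw [this, Real.mul_rpow (by positivity) (sum_nonneg fun _ _ => by positivity),
      Real.inv_rpow (by positivity), ← Real.rpow_mul hl.le]
    congr 3
    ring
  have e3 : ∀ ε, ‖m⁻¹ • (‖f ε‖ ^ (p - 2) • f ε)‖ ^ (1 + a) = (m ^ (1 + a))⁻¹ * ‖f ε‖ ^ p := by
    intro ε
    rw [norm_smul, norm_smul, Real.norm_of_nonneg (by positivity : 0 ≤ m⁻¹),
      Real.norm_of_nonneg (by positivity), Real.mul_rpow (by positivity) (by positivity),
      Real.inv_rpow hm.le]
    congr 1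
    rcases (norm_nonneg (f ε)).eq_or_lt with h0 | h0
    · rw [← h0, Real.zero_rpow (by linarith : p ≠ 0), mul_zero, Real.zero_rpow (by linarith)]
    · have : ‖f ε‖ ^ (p - 2) * ‖f ε‖ = ‖f ε‖ ^ (p - 1) := by
        conv_lhs => rw [← Real.rpow_add_one h0.ne']
        congr 1; ring
      rw [this, ← Real.rpow_mul h0.le, hp1]
  simp_rw [e1, e2, e3] at h
  have h' : ∑ ε, l⁻¹ * m⁻¹ * ‖f ε‖ ^ p ≤ 4 * ∑ ε, ((α + β) *
      ((l ^ p)⁻¹ * (∑ i, ‖Dop i (F i) ε‖ ^ 2) ^ (p / 2) + (m ^ (1 + a))⁻¹ * ‖f ε‖ ^ p + 2)) := by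
    refine h.trans ?_
    gcongr with ε _
    have x1 : 0 ≤ (l ^ p)⁻¹ * (∑ i, ‖Dop i (F i) ε‖ ^ 2) ^ (p / 2) := by positivity
    have x2 : 0 ≤ (m ^ (1 + a))⁻¹ * ‖f ε‖ ^ p := by positivity
    nlinarith [mul_nonneg hα0 x2, mul_nonneg hβ0 x1]
  have h2 := mul_le_mul_of_nonneg_left h' (by positivity : (0:ℝ) ≤ (2 ^ n)⁻¹)
  have hN : (2 ^ n : ℝ)⁻¹ * 2 ^ n = 1 := inv_mul_cancel₀ (by positivity)
  simp only [← mul_sum, sum_add_distrib, sum_const, card_univ, Fintype.card_fun, Fintype.card_bool,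
    Fintype.card_fin, nsmul_eq_mul] at h2
  push_cast at h2
  unfold cubeAvg
  simp only [smul_eq_mul]
  generalize ∑ ε, ‖f ε‖ ^ p = S at *
  generalize ∑ ε, (∑ i, ‖Dop i (F i) ε‖ ^ 2) ^ (p / 2) = T at *
  calc _ = (2 ^ n)⁻¹ * (l⁻¹ * m⁻¹ * S) := by ring
    _ ≤ _ := h2
    _ = 4 * (α + β) * ((l ^ p)⁻¹ * ((2 ^ n)⁻¹ * T) + (m ^ (1 + a))⁻¹ * ((2 ^ n)⁻¹ * S)
          + 2 * ((2 ^ n : ℝ)⁻¹ * 2 ^ n)) := by ring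
    _ = _ := by rw [hN]; ring
end fin

/-- `ℓ²`-valued Riesz estimate from below, `p ≥ 2`. -/
theorem riesz_below_l2 (p : ℝ) (hp : 2 ≤ p) :
    ∃ C : ℝ, ∀ (n R : ℕ) (F : Fin n → (Fin n → Bool) → EuclideanSpace ℝ (Fin R)),
      cubeAvg (fun ε => ‖∑ i, lapPow (-(1 / 2)) (Dop i (F i)) ε‖ ^ p) ≤
        C * cubeAvg (fun δ : Fin n → Bool => cubeAvg (fun ε =>
          ‖∑ i, rad (δ i) • Dop i (F i) ε‖ ^ p)) := by
  have hp0 : 0 < p - 1 := by linarith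
  have P : RbPar (11 * 16 ^ (p / 2 - 1)) (41 / (1 / (p - 1))) p (1 / (p - 1)) :=
    { hp := hp
      ha0 := by positivity
      ha1 := by rw [div_le_one hp0]; linarith
      hpa := by field_simp; ring
      hA := le_rfl
      hK := by rw [div_mul_cancel₀ _ (by positivity)] }
  refine ⟨_, fun n R F => (rb_dual P (by field_simp; ring) F).trans
    (mul_le_mul_of_nonneg_left ?_ (Real.rpow_nonneg (by positivity) _))⟩
  have hsw : cubeAvg (fun δ : Fin n → Bool => cubeAvg (fun ε =>
          ‖∑ i, rad (δ i) • Dop i (F i) ε‖ ^ p)) = cubeAvg (fun ε : Fin n → Bool =>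
          cubeAvg (fun δ => ‖∑ i, rad (δ i) • Dop i (F i) ε‖ ^ p)) := by
    simp only [cubeAvg, ← smul_sum]
    rw [sum_comm]
  rw [hsw]
  unfold cubeAvg
  simp only [smul_eq_mul]
  gcongr with ε _
  exact rb_khinchine hp (fun i => Dop i (F i) ε)

end
end

section
/- For every p ∈ [1,∞) there exists c_p > 0 such that for every n ≥ 2 the following holds. Let X_n be the Banach space of real-valued functions on {-1,1}^n equipped with the supremum norm, and define F : {-1,1}^n → X_n by F(ε)(η) = max(0, log((Σ_{i=1}^n (1 − ε_i η_i)/2) / √n)). Then (E_ε‖F − E_ε F‖_{X_n}^p)^{1/p} ≥ c_p · log n · (E_{ε,δ}‖Σ_{i=1}^n δ_i D_i F(ε)‖_{X_n}^p)^{1/p}. Consequently the Pisier inequality for X_n-valued functions cannot hold with a constant growing slower than c_p log n. -/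
open scoped BigOperators
open Finset

noncomputable section

/-- Talagrand's function `F(ε)(η) = log⁺( (Σ_i (1-ε_iη_i)/2) / √n )`, viewed as a map
from the cube to the space `X_n` of real functions on the cube with the sup norm. -/
def talF (n : ℕ) : (Fin n → Bool) → (Fin n → Bool) → ℝ :=
  fun ε η => max 0 (Real.log ((∑ i, (1 - rad (ε i) * rad (η i)) / 2) / Real.sqrt n))

theorem sum_rad_hamming {n : ℕ} (ε η : Fin n → Bool) :
    (∑ i, (1 - rad (ε i) * rad (η i)) / 2) = (hammingDist ε η : ℝ) := by
  unfold hammingDist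
  rw [Finset.card_filter]
  push_cast
  refine Finset.sum_congr rfl fun i _ => ?_
  cases ε i <;> cases η i <;> simp [rad]

/-- One-dimensional profile. -/
def talL (n k : ℕ) : ℝ := max 0 (Real.log ((k : ℝ) / Real.sqrt n))

theorem talF_eq {n : ℕ} (ε η : Fin n → Bool) : talF n ε η = talL n (hammingDist ε η) := by
  unfold talF talL
  rw [sum_rad_hamming]

theorem talL_nonneg (n k : ℕ) : 0 ≤ talL n k := le_max_left _ _

theorem talL_small {n k : ℕ} (hn : 2 ≤ n) (h : (k : ℝ) ≤ Real.sqrt n) : talL n k = 0 := by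
  unfold talL
  apply max_eq_left
  apply Real.log_nonpos (by positivity)
  exact div_le_one_of_le₀ h (by positivity)

theorem talL_mono {n : ℕ} (hn : 2 ≤ n) : Monotone (talL n) := by
  have hs : 0 < Real.sqrt n := Real.sqrt_pos.2 (by positivity)
  intro a b hab
  rcases Nat.eq_zero_or_pos a with rfl | ha
  · rw [talL_small hn (by simp)]
    exact talL_nonneg _ _
  · unfold talL
    have : (a : ℝ) ≤ b := by exact_mod_cast hab
    have ha' : (0 : ℝ) < a := by exact_mod_cast ha
    gcongr

theorem talL_diff {n : ℕ} (hn : 2 ≤ n) (k : ℕ) :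
    talL n (k + 1) - talL n k ≤ 2 / ((k : ℝ) + 1) := by
  have hs : 0 < Real.sqrt n := Real.sqrt_pos.2 (by positivity)
  have h2 : (0 : ℝ) ≤ 2 / ((k : ℝ) + 1) := by positivity
  rcases Nat.eq_zero_or_pos k with rfl | hk
  · rw [talL_small hn (k := 0 + 1), talL_small hn (k := 0)]
    · simp
    · simp
    · simp only [zero_add, Nat.cast_one]
      rw [Real.one_le_sqrt]
      exact_mod_cast (by omega : 1 ≤ n)
  · have hk' : (1 : ℝ) ≤ k := by exact_mod_cast hk
    have h1 : Real.log (((k + 1 : ℕ) : ℝ) / Real.sqrt n) - Real.log ((k : ℝ) / Real.sqrt n)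
        ≤ 2 / ((k : ℝ) + 1) := by
      rw [Real.log_div (by positivity) hs.ne', Real.log_div (by positivity) hs.ne']
      have h3 : Real.log (((k + 1 : ℕ) : ℝ)) - Real.log k = Real.log (((k : ℝ) + 1) / k) := by
        rw [Real.log_div (by positivity) (by positivity)]
        push_cast; ring
      have h4 : Real.log (((k : ℝ) + 1) / k) ≤ ((k : ℝ) + 1) / k - 1 :=
        Real.log_le_sub_one_of_pos (by positivity)
      have h5 : ((k : ℝ) + 1) / k - 1 ≤ 2 / ((k : ℝ) + 1) := by
        have : ((k : ℝ) + 1) / k - 1 = 1 / k := by field_simp; ring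
        rw [this, div_le_div_iff₀ (by positivity) (by positivity)]
        linarith
      linarith
    unfold talL
    rcases max_cases (0 : ℝ) (Real.log (((k + 1 : ℕ) : ℝ) / Real.sqrt n)) with ⟨h, _⟩ | ⟨h, _⟩ <;>
    rw [h] <;> have := le_max_right (0 : ℝ) (Real.log ((k : ℝ) / Real.sqrt n)) <;>
    have := le_max_left (0 : ℝ) (Real.log ((k : ℝ) / Real.sqrt n)) <;> linarith

theorem talL_diff' {n : ℕ} (hn : 2 ≤ n) (k : ℕ) :
    talL n (k + 1) - talL n k ≤ 2 / Real.sqrt n := by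
  have hs : 0 < Real.sqrt n := Real.sqrt_pos.2 (by positivity)
  by_cases h : ((k + 1 : ℕ) : ℝ) ≤ Real.sqrt n
  · rw [talL_small hn h]
    have := talL_nonneg n k
    have : 0 ≤ 2 / Real.sqrt n := by positivity
    linarith
  · refine (talL_diff hn k).trans ?_
    push_cast at h
    gcongr
    linarith

theorem flip_self {n : ℕ} (ε : Fin n → Bool) (i : Fin n) : flipCoord i ε i = !(ε i) := by
  simp [flipCoord]

theorem flip_other {n : ℕ} (ε : Fin n → Bool) {i j : Fin n} (h : ¬ j = i) :
    flipCoord i ε j = ε j := by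
  simp [flipCoord, h]

theorem hamming_flip_ne {n : ℕ} (ε η : Fin n → Bool) (i : Fin n) (h : ε i ≠ η i) :
    hammingDist (flipCoord i ε) η + 1 = hammingDist ε η := by
  unfold hammingDist
  have : (univ.filter fun j => ε j ≠ η j) = insert i (univ.filter fun j => flipCoord i ε j ≠ η j) := by
    ext j
    by_cases hj : j = i
    · subst hj; simp [h]
    · simp only [mem_insert, mem_filter, mem_univ, true_and, flip_other ε hj, hj, false_or]
  rw [this, Finset.card_insert_of_notMem]
  simp only [mem_filter, mem_univ, true_and, flip_self]
  revert h
  cases ε i <;> cases η i <;> simp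

theorem hamming_flip_eq {n : ℕ} (ε η : Fin n → Bool) (i : Fin n) (h : ε i = η i) :
    hammingDist (flipCoord i ε) η = hammingDist ε η + 1 := by
  unfold hammingDist
  have : (univ.filter fun j => flipCoord i ε j ≠ η j) = insert i (univ.filter fun j => ε j ≠ η j) := by
    ext j
    by_cases hj : j = i
    · subst hj; simp [flipCoord, h]
    · simp only [mem_insert, mem_filter, mem_univ, true_and, flip_other ε hj, hj, false_or]
  rw [this, Finset.card_insert_of_notMem]
  simp [h]

theorem abs_rad (b : Bool) : |rad b| = 1 := by cases b <;> simp [rad]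

theorem pointwise_bound {n : ℕ} (hn : 2 ≤ n) (ε δ η : Fin n → Bool) :
    |(∑ i, rad (δ i) • Dop i (talF n) ε) η| ≤ 2 + |∑ i, rad (δ i)| / Real.sqrt n := by
  have hs : 0 < Real.sqrt n := Real.sqrt_pos.2 (by positivity)
  set k := hammingDist ε η with hk
  set A := univ.filter fun i => ε i ≠ η i with hA
  have hcard : A.card = k := rfl
  set a : ℝ := (talL n k - talL n (k - 1)) / 2 with ha
  set b : ℝ := (talL n (k + 1) - talL n k) / 2 with hb
  have hD : ∀ i, rad (δ i) * Dop i (talF n) ε η =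
      (a + b) * (if ε i ≠ η i then rad (δ i) else 0) - b * rad (δ i) := by
    intro i
    simp only [Dop, Pi.smul_apply, Pi.sub_apply, talF_eq, smul_eq_mul]
    by_cases h : ε i = η i
    · rw [hamming_flip_eq ε η i h]
      simp [h, ha, hb, ← hk]; ring
    · have h1 := hamming_flip_ne ε η i h
      have h2 : hammingDist (flipCoord i ε) η = k - 1 := by omega
      rw [h2]
      simp [h, ha, hb, ← hk]; ring
  have hsum : (∑ i, rad (δ i) • Dop i (talF n) ε) η =
      (a + b) * (∑ i ∈ A, rad (δ i)) - b * ∑ i, rad (δ i) := by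
    rw [Finset.sum_apply]
    simp only [Pi.smul_apply, smul_eq_mul]
    rw [Finset.sum_congr rfl fun i _ => hD i, Finset.sum_sub_distrib, ← Finset.mul_sum,
      ← Finset.mul_sum, Finset.sum_filter]
  have hSA : |∑ i ∈ A, rad (δ i)| ≤ k := by
    refine (Finset.abs_sum_le_sum_abs _ _).trans ?_
    simp [abs_rad, hcard]
  have ha0 : 0 ≤ a := by
    have := talL_mono hn (Nat.sub_le k 1)
    simp only [ha]; linarith
  have hb0 : 0 ≤ b := by
    have := talL_mono hn (Nat.le_succ k)
    simp only [hb]; simp only [Nat.succ_eq_add_one] at this; linarith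
  have hbk : b * k ≤ 1 := by
    have h := talL_diff hn k
    have h1 : b ≤ 1 / ((k : ℝ) + 1) := by
      have : 2 / ((k : ℝ) + 1) = 2 * (1 / ((k : ℝ) + 1)) := by ring
      simp only [hb]; linarith
    calc b * k ≤ 1 / ((k : ℝ) + 1) * k := by gcongr
      _ ≤ 1 := by rw [one_div_mul_eq_div]; exact div_le_one_of_le₀ (by linarith) (by positivity)
  have hak : a * k ≤ 1 := by
    rcases Nat.eq_zero_or_pos k with h0 | h0
    · simp [h0]
    · obtain ⟨m, hm⟩ := Nat.exists_eq_succ_of_ne_zero h0.ne'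
      have h := talL_diff hn m
      have h1 : a ≤ 1 / ((m : ℝ) + 1) := by
        have : 2 / ((m : ℝ) + 1) = 2 * (1 / ((m : ℝ) + 1)) := by ring
        simp only [ha, hm, Nat.succ_eq_add_one, Nat.add_sub_cancel]; linarith
      have hkm : (k : ℝ) = m + 1 := by rw [hm]; push_cast; ring
      calc a * k ≤ 1 / ((m : ℝ) + 1) * k := by gcongr
        _ = 1 := by rw [hkm]; field_simp
  have hbs : b ≤ 1 / Real.sqrt n := by
    have h := talL_diff' hn k
    have : 2 / Real.sqrt n = 2 * (1 / Real.sqrt n) := by ring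
    simp only [hb]; linarith
  rw [hsum]
  calc |(a + b) * (∑ i ∈ A, rad (δ i)) - b * ∑ i, rad (δ i)|
      ≤ |(a + b) * (∑ i ∈ A, rad (δ i))| + |b * ∑ i, rad (δ i)| := abs_sub _ _
    _ = (a + b) * |∑ i ∈ A, rad (δ i)| + b * |∑ i, rad (δ i)| := by
        rw [abs_mul, abs_mul, abs_of_nonneg hb0, abs_of_nonneg (add_nonneg ha0 hb0)]
    _ ≤ (a + b) * k + 1 / Real.sqrt n * |∑ i, rad (δ i)| := by gcongr
    _ ≤ 2 + |∑ i, rad (δ i)| / Real.sqrt n := by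
        rw [one_div_mul_eq_div, add_mul]; linarith

theorem norm_bound {n : ℕ} (hn : 2 ≤ n) (ε δ : Fin n → Bool) :
    ‖∑ i, rad (δ i) • Dop i (talF n) ε‖ ≤ 2 + |∑ i, rad (δ i)| / Real.sqrt n := by
  rw [pi_norm_le_iff_of_nonneg (by positivity)]
  intro η
  rw [Real.norm_eq_abs]
  exact pointwise_bound hn ε δ η

theorem cubeAvg_mono {n : ℕ} {f g : (Fin n → Bool) → ℝ} (h : ∀ ε, f ε ≤ g ε) :
    cubeAvg f ≤ cubeAvg g := by
  unfold cubeAvg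
  simp only [smul_eq_mul]
  exact mul_le_mul_of_nonneg_left (Finset.sum_le_sum fun ε _ => h ε) (by positivity)

theorem cubeAvg_const {n : ℕ} (c : ℝ) : cubeAvg (fun _ : Fin n → Bool => c) = c := by
  unfold cubeAvg
  simp

theorem mgf_eq {n : ℕ} (t : ℝ) :
    cubeAvg (fun δ : Fin n → Bool => Real.exp (t * ∑ i, rad (δ i))) = Real.cosh t ^ n := by
  unfold cubeAvg
  have h : ∀ δ : Fin n → Bool, Real.exp (t * ∑ i, rad (δ i)) = ∏ i, Real.exp (t * rad (δ i)) := by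
    intro δ
    rw [Finset.mul_sum, Real.exp_sum]
  simp only [h, smul_eq_mul]
  have h2 := (Finset.prod_univ_sum (fun _ : Fin n => (univ : Finset Bool))
    (fun _ b => Real.exp (t * rad b)))
  rw [Fintype.piFinset_univ] at h2
  rw [← h2]
  simp only [Fintype.sum_bool, Finset.prod_const, Finset.card_univ, Fintype.card_fin]
  rw [← inv_pow, ← mul_pow, Real.cosh_eq]
  congr 1
  simp [rad]
  ring

theorem mgf_le {n : ℕ} (hn : 2 ≤ n) (t : ℝ) (ht : t ^ 2 = 1 / n) :
    cubeAvg (fun δ : Fin n → Bool => Real.exp (t * ∑ i, rad (δ i))) ≤ Real.exp (1 / 2) := by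
  rw [mgf_eq]
  calc Real.cosh t ^ n ≤ Real.exp (t ^ 2 / 2) ^ n := by
        gcongr
        exact Real.cosh_le_exp_half_sq t
    _ = Real.exp (1 / 2) := by
        rw [← Real.exp_nat_mul, ht]
        congr 1
        have : (n : ℝ) ≠ 0 := by positivity
        field_simp

theorem abs_mgf_le {n : ℕ} (hn : 2 ≤ n) :
    cubeAvg (fun δ : Fin n → Bool => Real.exp (|∑ i, rad (δ i)| / Real.sqrt n)) ≤
      2 * Real.exp (1 / 2) := by
  have hs : 0 < Real.sqrt n := Real.sqrt_pos.2 (by positivity)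
  have hsq : (1 / Real.sqrt n) ^ 2 = 1 / n := by
    rw [div_pow, Real.sq_sqrt (by positivity), one_pow]
  have h1 := mgf_le hn (1 / Real.sqrt n) hsq
  have h2 := mgf_le hn (-(1 / Real.sqrt n)) (by rw [neg_sq]; exact hsq)
  have h3 : cubeAvg (fun δ : Fin n → Bool => Real.exp (|∑ i, rad (δ i)| / Real.sqrt n)) ≤
      cubeAvg (fun δ : Fin n → Bool => Real.exp (1 / Real.sqrt n * ∑ i, rad (δ i)) +
        Real.exp (-(1 / Real.sqrt n) * ∑ i, rad (δ i))) := by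
    apply cubeAvg_mono
    intro δ
    rcases abs_cases (∑ i, rad (δ i)) with ⟨h, _⟩ | ⟨h, _⟩ <;> rw [h]
    · rw [one_div_mul_eq_div]
      have := Real.exp_pos (-(1 / Real.sqrt n) * ∑ i, rad (δ i))
      linarith
    · have e : -(1 / Real.sqrt n) * ∑ i, rad (δ i) = -(∑ i, rad (δ i)) / Real.sqrt n := by ring
      rw [e]
      have := Real.exp_pos (1 / Real.sqrt n * ∑ i, rad (δ i))
      linarith
  refine h3.trans ?_
  have h4 : cubeAvg (fun δ : Fin n → Bool => Real.exp (1 / Real.sqrt n * ∑ i, rad (δ i)) +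
        Real.exp (-(1 / Real.sqrt n) * ∑ i, rad (δ i))) =
      cubeAvg (fun δ : Fin n → Bool => Real.exp (1 / Real.sqrt n * ∑ i, rad (δ i))) +
      cubeAvg (fun δ : Fin n → Bool => Real.exp (-(1 / Real.sqrt n) * ∑ i, rad (δ i))) := by
    unfold cubeAvg
    rw [Finset.sum_add_distrib, smul_add]
  rw [h4]; linarith

/-- The moment constant. -/
def momK (p : ℝ) : ℝ := (⌈p⌉₊.factorial : ℝ) * Real.exp 2 * (2 * Real.exp (1 / 2))

theorem momK_pos (p : ℝ) : 0 < momK p := by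
  unfold momK
  have : (0 : ℝ) < ⌈p⌉₊.factorial := by exact_mod_cast Nat.factorial_pos _
  positivity

theorem inner_bound {n : ℕ} (hn : 2 ≤ n) (p : ℝ) (hp : 1 ≤ p) (ε : Fin n → Bool) :
    cubeAvg (fun δ : Fin n → Bool => ‖∑ i, rad (δ i) • Dop i (talF n) ε‖ ^ p) ≤ momK p := by
  have h : ∀ δ : Fin n → Bool, ‖∑ i, rad (δ i) • Dop i (talF n) ε‖ ^ p ≤
      ((⌈p⌉₊.factorial : ℝ) * Real.exp 2) * Real.exp (|∑ i, rad (δ i)| / Real.sqrt n) := by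
    intro δ
    set T := |∑ i, rad (δ i)| / Real.sqrt n with hT
    have hT0 : 0 ≤ T := by positivity
    have hf : (0 : ℝ) < ⌈p⌉₊.factorial := by exact_mod_cast Nat.factorial_pos _
    calc ‖∑ i, rad (δ i) • Dop i (talF n) ε‖ ^ p ≤ (2 + T) ^ p :=
          Real.rpow_le_rpow (norm_nonneg _) (norm_bound hn ε δ) (by linarith)
      _ ≤ (2 + T) ^ ((⌈p⌉₊ : ℕ) : ℝ) :=
          Real.rpow_le_rpow_of_exponent_le (by linarith) (Nat.le_ceil p)
      _ = (2 + T) ^ ⌈p⌉₊ := Real.rpow_natCast _ _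
      _ ≤ (⌈p⌉₊.factorial : ℝ) * Real.exp (2 + T) := by
          have := Real.pow_div_factorial_le_exp (2 + T) (by linarith) ⌈p⌉₊
          rw [div_le_iff₀ hf] at this
          linarith
      _ = _ := by rw [Real.exp_add]; ring
  refine (cubeAvg_mono h).trans ?_
  have h2 : cubeAvg (fun δ : Fin n → Bool =>
      ((⌈p⌉₊.factorial : ℝ) * Real.exp 2) * Real.exp (|∑ i, rad (δ i)| / Real.sqrt n)) =
      ((⌈p⌉₊.factorial : ℝ) * Real.exp 2) *
        cubeAvg (fun δ : Fin n → Bool => Real.exp (|∑ i, rad (δ i)| / Real.sqrt n)) := by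
    unfold cubeAvg
    simp only [smul_eq_mul]
    rw [← Finset.mul_sum]; ring
  rw [h2]
  unfold momK
  exact mul_le_mul_of_nonneg_left (abs_mgf_le hn) (by positivity)

theorem hamming_compl {n : ℕ} (ε η : Fin n → Bool) :
    hammingDist ε η + hammingDist (fun i => !(ε i)) η = n := by
  unfold hammingDist
  have := Finset.card_filter_add_card_filter_not (s := (univ : Finset (Fin n)))
    (fun i => ε i ≠ η i)
  rw [Finset.card_univ, Fintype.card_fin] at this
  refine Eq.trans ?_ this
  congr 2
  ext i
  simp only [mem_filter, mem_univ, true_and]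
  cases ε i <;> cases η i <;> simp

theorem avg_lower {n : ℕ} (hn : 2 ≤ n) (η : Fin n → Bool) :
    (1 / 2 ^ 17) * Real.log n ≤ cubeAvg (fun ε => talL n (hammingDist ε η)) := by
  have hs : 0 < Real.sqrt n := Real.sqrt_pos.2 (by positivity)
  have hn0 : (0 : ℝ) < n := by positivity
  have hlog : 0 ≤ Real.log n := Real.log_natCast_nonneg n
  by_cases h16 : n ≤ 16
  · have hL : Real.log n / 2 ≤ talL n n := by
      unfold talL
      rw [Real.div_sqrt, Real.log_sqrt hn0.le]
      exact le_max_right _ _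
    have h1 : talL n n ≤ ∑ ε : Fin n → Bool, talL n (hammingDist ε η) := by
      have h2 : hammingDist (fun i => !(η i)) η = n := by
        have := hamming_compl η η
        simpa using this
      have := Finset.single_le_sum (f := fun ε : Fin n → Bool => talL n (hammingDist ε η))
        (fun ε _ => talL_nonneg _ _) (Finset.mem_univ (fun i => !(η i)))
      simpa only [h2] using this
    unfold cubeAvg
    rw [smul_eq_mul]
    have h3 : (1 / 2 ^ 16 : ℝ) ≤ (2 ^ n : ℝ)⁻¹ := by
      rw [one_div]
      gcongr
      norm_num
    calc (1 / 2 ^ 17) * Real.log n = (1 / 2 ^ 16) * (Real.log n / 2) := by ring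
      _ ≤ (2 ^ n : ℝ)⁻¹ * ∑ ε : Fin n → Bool, talL n (hammingDist ε η) := by
        gcongr
        linarith
  · push Not at h16
    have h16' : (16 : ℝ) ≤ n := by exact_mod_cast h16.le
    have hinv : cubeAvg (fun ε : Fin n → Bool => talL n (hammingDist (fun i => !(ε i)) η)) =
        cubeAvg (fun ε : Fin n → Bool => talL n (hammingDist ε η)) := by
      unfold cubeAvg
      congr 1
      refine Fintype.sum_equiv
        (Function.Involutive.toPerm (fun (ε : Fin n → Bool) i => !(ε i))
          (fun ε => by funext i; simp)) _ _ ?_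
      intro ε
      rfl
    have hpt : ∀ ε : Fin n → Bool, Real.log n / 4 ≤
        talL n (hammingDist ε η) + talL n (hammingDist (fun i => !(ε i)) η) := by
      intro ε
      have hc := hamming_compl ε η
      have key : ∀ k : ℕ, n ≤ 2 * k → Real.log n / 4 ≤ talL n k := by
        intro k hk
        have hk' : (n : ℝ) ≤ 2 * k := by exact_mod_cast hk
        have hk0 : (0 : ℝ) < k := by linarith
        unfold talL
        refine le_trans ?_ (le_max_right _ _)
        rw [Real.log_div hk0.ne' hs.ne', Real.log_sqrt hn0.le]
        have e1 : Real.log n ≤ Real.log 2 + Real.log k := by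
          rw [← Real.log_mul (by norm_num) hk0.ne']
          exact Real.log_le_log hn0 hk'
        have e2 : 4 * Real.log 2 ≤ Real.log n := by
          have : 4 * Real.log 2 = Real.log 16 := by
            rw [show (16 : ℝ) = 2 ^ 4 by norm_num, Real.log_pow]; norm_num
          rw [this]
          exact Real.log_le_log (by norm_num) h16'
        linarith
      have p1 := talL_nonneg n (hammingDist ε η)
      have p2 := talL_nonneg n (hammingDist (fun i => !(ε i)) η)
      rcases le_total n (2 * hammingDist ε η) with h | h
      · have := key _ h; linarith
      · have := key (hammingDist (fun i => !(ε i)) η) (by omega)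
        linarith
    have hm := cubeAvg_mono hpt
    rw [cubeAvg_const] at hm
    have hadd : cubeAvg (fun ε : Fin n → Bool =>
        talL n (hammingDist ε η) + talL n (hammingDist (fun i => !(ε i)) η)) =
        cubeAvg (fun ε : Fin n → Bool => talL n (hammingDist ε η)) +
        cubeAvg (fun ε : Fin n → Bool => talL n (hammingDist (fun i => !(ε i)) η)) := by
      unfold cubeAvg
      rw [Finset.sum_add_distrib, smul_add]
    rw [hadd, hinv] at hm
    have : (1 / 2 ^ 17) * Real.log n ≤ Real.log n / 8 := by
      have : (1 / 2 ^ 17 : ℝ) ≤ 1 / 8 := by norm_num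
      nlinarith
    linarith

theorem norm_lower {n : ℕ} (hn : 2 ≤ n) (ε : Fin n → Bool) :
    (1 / 2 ^ 17) * Real.log n ≤ ‖talF n ε - cubeAvg (talF n)‖ := by
  have h := norm_le_pi_norm (talF n ε - cubeAvg (talF n)) ε
  refine le_trans ?_ h
  have h0 : talF n ε ε = 0 := by
    rw [talF_eq, hammingDist_self]
    exact talL_small hn (by simp)
  have h1 : (cubeAvg (talF n)) ε = cubeAvg (fun ε' => talL n (hammingDist ε' ε)) := by
    unfold cubeAvg
    rw [Pi.smul_apply, Finset.sum_apply]
    simp only [talF_eq]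
  rw [Pi.sub_apply, h0, h1, zero_sub, norm_neg, Real.norm_eq_abs]
  exact (avg_lower hn ε).trans (le_abs_self _)

/-- Talagrand's counterexample — the `X_n`-valued Pisier inequality
fails with any constant of order `o(log n)`. Here `X_n = (Fin n → Bool) → ℝ` carries
the sup norm (the `Pi` norm on a finite index type). -/
theorem talagrand_counterexample (p : ℝ) (hp : 1 ≤ p) :
    ∃ c : ℝ, 0 < c ∧ ∀ (n : ℕ), 2 ≤ n →
      (cubeAvg (fun ε => ‖talF n ε - cubeAvg (talF n)‖ ^ p)) ^ (1 / p) ≥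
        c * Real.log n *
          (cubeAvg (fun ε => cubeAvg (fun δ : Fin n → Bool =>
            ‖∑ i, rad (δ i) • Dop i (talF n) ε‖ ^ p))) ^ (1 / p) := by
  have hp0 : 0 < p := by linarith
  have hK := momK_pos p
  have hK' : 0 < momK p ^ (1 / p) := Real.rpow_pos_of_pos hK _
  refine ⟨(1 / 2 ^ 17) / momK p ^ (1 / p), by positivity, ?_⟩
  intro n hn
  have hlog : 0 ≤ Real.log n := Real.log_natCast_nonneg n
  have hl : (1 / 2 ^ 17) * Real.log n ≤
      (cubeAvg (fun ε => ‖talF n ε - cubeAvg (talF n)‖ ^ p)) ^ (1 / p) := by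
    have h1 : ((1 / 2 ^ 17) * Real.log n) ^ p ≤
        cubeAvg (fun ε => ‖talF n ε - cubeAvg (talF n)‖ ^ p) := by
      rw [← cubeAvg_const (n := n) (((1 / 2 ^ 17) * Real.log n) ^ p)]
      apply cubeAvg_mono
      intro ε
      exact Real.rpow_le_rpow (by positivity) (norm_lower hn ε) hp0.le
    calc (1 / 2 ^ 17) * Real.log n = (((1 / 2 ^ 17) * Real.log n) ^ p) ^ (1 / p) := by
          rw [one_div p, Real.rpow_rpow_inv (by positivity) hp0.ne']
      _ ≤ _ := Real.rpow_le_rpow (by positivity) h1 (by positivity)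
  have hr : (cubeAvg (fun ε => cubeAvg (fun δ : Fin n → Bool =>
            ‖∑ i, rad (δ i) • Dop i (talF n) ε‖ ^ p))) ^ (1 / p) ≤ momK p ^ (1 / p) := by
    apply Real.rpow_le_rpow
    · unfold cubeAvg
      simp only [smul_eq_mul]
      positivity
    · refine (cubeAvg_mono fun ε => inner_bound hn p hp ε).trans ?_
      rw [cubeAvg_const]
    · positivity
  refine le_trans ?_ hl
  calc _ ≤ (1 / 2 ^ 17) / momK p ^ (1 / p) * Real.log n * momK p ^ (1 / p) :=
        mul_le_mul_of_nonneg_left hr (by positivity)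
    _ = (1 / 2 ^ 17) * Real.log n := by field_simp

end
end
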